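/- Let F be a funnel with base endpoints l₁ and r₁ and apex α, and let l₁, l₂, …, l_k = α be the vertices of the left chain of F, i.e., the vertices in order along the boundary of F from l₁ to α not passing through r₁. Then for every point p ∈ F, the set of indices { i : p sees l_i } is a set of consecutive integers (an interval of indices); that is, any point of a funnel sees a consecutive section of each of its two chains. -/

import Mathlib

/-- A simple polygon: a cyclic sequence of `n ≥ 3` distinct points in the plane
(`ℝ × ℝ`) whose closed edges `[vtx i, vtx (i+1)]` (indices mod `n`) are pairwise
disjoint, except that consecutive edges share exactly their common endpoint. -/
structure SimplePolygon where
  n : ℕ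
  three_le : 3 ≤ n
  vtx : Fin n → ℝ × ℝ
  inj : Function.Injective vtx
  consec_edges : ∀ i : Fin n,
    haveI : NeZero n := ⟨by omega⟩
    segment ℝ (vtx i) (vtx (i + 1)) ∩ segment ℝ (vtx (i + 1)) (vtx (i + 1 + 1))
      = {vtx (i + 1)}
  nonconsec_edges : ∀ i j : Fin n,
    haveI : NeZero n := ⟨by omega⟩
    i ≠ j → j ≠ i + 1 → i ≠ j + 1 →
      segment ℝ (vtx i) (vtx (i + 1)) ∩ segment ℝ (vtx j) (vtx (j + 1)) = ∅

instance (P : SimplePolygon) : NeZero P.n := ⟨by have := P.three_le; omega⟩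

namespace SimplePolygon

/-- The boundary of the polygon: the union of its edges. -/
def boundary (P : SimplePolygon) : Set (ℝ × ℝ) :=
  ⋃ i : Fin P.n, segment ℝ (P.vtx i) (P.vtx (i + 1))

/-- The polygon as a point set: its boundary together with the union of all
bounded connected components of the complement of the boundary. -/
def region (P : SimplePolygon) : Set (ℝ × ℝ) :=
  P.boundary ∪
    {p | p ∉ P.boundary ∧ Bornology.IsBounded (connectedComponentIn P.boundaryᶜ p)}

/-- `p` sees `q` if the closed segment between them lies in the polygon. -/
def Sees (P : SimplePolygon) (p q : ℝ × ℝ) : Prop :=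
  segment ℝ p q ⊆ P.region

/-- The planar cross product of two vectors. -/
def cross2 (a b : ℝ × ℝ) : ℝ := a.1 * b.2 - a.2 * b.1

/-- Counterclockwise orientation: positive shoelace signed area. -/
def Ccw (P : SimplePolygon) : Prop :=
  0 < ∑ i : Fin P.n, cross2 (P.vtx i) (P.vtx (i + 1))

/-- A vertex is convex if the cross product of the incoming and the outgoing
edge vectors is positive (for a counterclockwise-oriented polygon). -/
def ConvexVtx (P : SimplePolygon) (i : Fin P.n) : Prop :=
  0 < cross2 (P.vtx i - P.vtx (i - 1)) (P.vtx (i + 1) - P.vtx i)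

/-- A funnel: a counterclockwise-oriented simple polygon with exactly three
convex vertices, two of which (the endpoints of the base edge) are adjacent;
the third convex vertex is the apex. -/
def IsFunnel (P : SimplePolygon) : Prop :=
  P.Ccw ∧ ∃ b c : Fin P.n, c ≠ b ∧ c ≠ b + 1 ∧
    {i : Fin P.n | P.ConvexVtx i} = {b, b + 1, c}

/-- `G` is a set of vertices of `P` such that every point of `P` is seen by
some vertex in `G`. -/
def GuardsAll (P : SimplePolygon) (G : Finset (ℝ × ℝ)) : Prop :=
  ↑G ⊆ Set.range P.vtx ∧ ∀ p ∈ P.region, ∃ g ∈ G, P.Sees g p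

/-- A vertex-to-point conflict-free chromatic guarding of `P` with `k` colours:
a set `G` of vertices of `P` together with a colouring `χ` (only its values on
`G` matter) such that every point of `P` sees at least one guard whose colour
is unique among the guards that this point sees. -/
def IsCFGuardV2P (P : SimplePolygon) (G : Finset (ℝ × ℝ)) (k : ℕ)
    (χ : ℝ × ℝ → Fin k) : Prop :=
  ↑G ⊆ Set.range P.vtx ∧
  ∀ p ∈ P.region, ∃ g ∈ G, P.Sees g p ∧
    ∀ h ∈ G, h ≠ g → P.Sees h p → χ h ≠ χ g

/-- A vertex-to-vertex conflict-free chromatic guarding of `P` with `k`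
colours: every vertex of `P` sees at least one guard whose colour is unique
among the guards that this vertex sees. -/
def IsCFGuardV2V (P : SimplePolygon) (G : Finset (ℝ × ℝ)) (k : ℕ)
    (χ : ℝ × ℝ → Fin k) : Prop :=
  ↑G ⊆ Set.range P.vtx ∧
  ∀ i : Fin P.n, ∃ g ∈ G, P.Sees g (P.vtx i) ∧
    ∀ h ∈ G, h ≠ g → P.Sees h (P.vtx i) → χ h ≠ χ g

end SimplePolygon

section
/-- signed angle from `a` to `b`. -/
noncomputable def fang (a b : ℂ) : ℝ := Complex.arg (b / a)

lemma fang_coe {a b : ℂ} (ha : a ≠ 0) (hb : b ≠ 0) :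
    ((fang a b : ℝ) : Real.Angle) = (Complex.arg b : Real.Angle) - (Complex.arg a : Real.Angle) :=
  Complex.arg_div_coe_angle hb ha

lemma fang_neg_neg (a b : ℂ) : fang (-a) (-b) = fang a b := by
  unfold fang; rw [neg_div_neg_eq]

lemma fang_le (a b : ℂ) : fang a b ≤ Real.pi := Complex.arg_le_pi _
lemma fang_gt (a b : ℂ) : -Real.pi < fang a b := Complex.neg_pi_lt_arg _

lemma fang_potential (f : ℂ →L[ℝ] ℝ) :
    ∃ φ : ℂ → ℝ, ∀ a b, 0 < f a → 0 < f b → fang a b = φ b - φ a := by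
  set u : ℂ := ⟨f 1, -f Complex.I⟩ with hu
  have key : ∀ x : ℂ, (x * u).re = f x := by
    intro x
    have : x = x.re • (1 : ℂ) + x.im • Complex.I := by
      apply Complex.ext <;> simp
    conv_rhs => rw [this, map_add, map_smul, map_smul]
    simp [hu, Complex.mul_re]
  refine ⟨fun x => Complex.arg (x * u), fun a b ha hb => ?_⟩
  rw [← key] at ha hb
  have hau : a * u ≠ 0 := by intro h; rw [h] at ha; simp at ha
  have hbu : b * u ≠ 0 := by intro h; rw [h] at hb; simp at hb
  have hu0 : u ≠ 0 := right_ne_zero_of_mul hau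
  have h1 : fang a b = Complex.arg ((b * u) / (a * u)) := by
    unfold fang; rw [mul_div_mul_right _ _ hu0]
  have h2 := Complex.arg_div_coe_angle hbu hau
  rw [← h1, ← Real.Angle.coe_sub] at h2
  have ha' := abs_lt.1 (Complex.abs_arg_lt_pi_div_two_iff.2 (Or.inl ha))
  have hb' := abs_lt.1 (Complex.abs_arg_lt_pi_div_two_iff.2 (Or.inl hb))
  have h3 : ((Complex.arg (b * u) - Complex.arg (a * u) : ℝ) : Real.Angle).toReal
      = Complex.arg (b * u) - Complex.arg (a * u) := by
    rw [Real.Angle.toReal_coe_eq_self_iff]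
    constructor <;> linarith
  have h4 : ((fang a b : ℝ) : Real.Angle).toReal = fang a b := by
    unfold fang; exact Complex.arg_coe_angle_toReal_eq_arg _
  show fang a b = Complex.arg (b * u) - Complex.arg (a * u)
  rw [← h3, ← h4, h2]

lemma fang_plaq {a b c d : ℂ} (h : Disjoint (segment ℝ a b) (segment ℝ c d)) :
    fang (c - a) (d - a) + fang (d - a) (d - b) = fang (c - a) (c - b) + fang (c - b) (d - b) := by
  have cpt : ∀ x y : ℂ, IsCompact (segment ℝ x y) := fun x y => by
    rw [← convexHull_pair (𝕜 := ℝ)]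
    exact (Set.toFinite _).isCompact_convexHull (𝕜 := ℝ)
  obtain ⟨f, s, t, h1, h2, h3⟩ := geometric_hahn_banach_compact_closed (convex_segment a b)
    (cpt a b) (convex_segment c d) (cpt c d).isClosed h
  obtain ⟨φ, hφ⟩ := fang_potential f
  have ha := h1 a (left_mem_segment ℝ a b)
  have hb := h1 b (right_mem_segment ℝ a b)
  have hc := h3 c (left_mem_segment ℝ c d)
  have hd := h3 d (right_mem_segment ℝ c d)
  rw [hφ, hφ, hφ, hφ]
  · ring
  all_goals rw [map_sub]; linarith

lemma fang_bend {p r : ℂ} (h : (0 : ℂ) ∉ segment ℝ p r) :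
    fang p r = fang p (p + r) + fang (p + r) r := by
  have cpt : ∀ x y : ℂ, IsCompact (segment ℝ x y) := fun x y => by
    rw [← convexHull_pair (𝕜 := ℝ)]
    exact (Set.toFinite _).isCompact_convexHull (𝕜 := ℝ)
  obtain ⟨f, s, t, h1, h2, h3⟩ := geometric_hahn_banach_compact_closed (convex_singleton (0 : ℂ))
    isCompact_singleton (convex_segment p r) (cpt p r).isClosed (by simpa using h)
  obtain ⟨φ, hφ⟩ := fang_potential f
  have h0 := h1 0 rfl
  rw [map_zero] at h0
  have hp := h3 p (left_mem_segment ℝ p r)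
  have hr := h3 r (right_mem_segment ℝ p r)
  rw [hφ, hφ, hφ]
  · ring
  all_goals (try rw [map_add]); linarith

/-- complex periodic presentation of a simple polygon with `N+2` vertices -/
structure CPoly (N : ℕ) (z : ℕ → ℂ) : Prop where
  hN : 1 ≤ N
  per : ∀ i, z (i + (N + 2)) = z i
  ne : ∀ s j, 1 ≤ j → j < N + 2 → z (s + j) ≠ z s
  disj : ∀ s j, 2 ≤ j → j ≤ N →
    Disjoint (segment ℝ (z s) (z (s + 1))) (segment ℝ (z (s + j)) (z (s + j + 1)))
  bend : ∀ s, segment ℝ (z s) (z (s + 1)) ∩ segment ℝ (z (s + 1)) (z (s + 2)) = {z (s + 1)}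

/-- angle at `p` of edge `j` -/
noncomputable def cA (z : ℕ → ℂ) (p : ℂ) (j : ℕ) : ℝ := fang (z j - p) (z (j + 1) - p)

/-- turn at vertex `s+1` -/
noncomputable def cT (z : ℕ → ℂ) (s : ℕ) : ℝ := fang (z (s + 1) - z s) (z (s + 2) - z (s + 1))

/-- sum of angles at `z s` of the non incident edges -/
noncomputable def cS (N : ℕ) (z : ℕ → ℂ) (s : ℕ) : ℝ :=
  ∑ j ∈ Finset.range N, cA z (z s) (s + 1 + j)

namespace CPoly
variable {N : ℕ} {z : ℕ → ℂ}

lemma zero_notMem (h : CPoly N z) (s : ℕ) {q : ℂ} (hq : q ∈ segment ℝ (z (s+1)) (z (s+2)))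
    (hq1 : q ≠ z (s+1)) :
    (0 : ℂ) ∉ segment ℝ (z (s + 1) - z s) (q - z (s + 1)) := by
  rintro ⟨a, b, ha, hb, hab, he⟩
  simp only [Complex.real_smul] at he
  have hx1 : z (s+1) - a * (z (s+1) - z s) ∈ segment ℝ (z s) (z (s+1)) := by
    refine ⟨a, 1 - a, ha, by linarith, by ring, ?_⟩
    simp only [Complex.real_smul]; push_cast; ring
  have hx2 : z (s+1) - a * (z (s+1) - z s) ∈ segment ℝ (z (s+1)) (z (s+2)) := by
    have : z (s+1) - a * (z (s+1) - z s) ∈ segment ℝ (z (s+1)) q := by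
      refine ⟨1 - b, b, by linarith, hb, by ring, ?_⟩
      simp only [Complex.real_smul]; push_cast; linear_combination he
    exact (convex_segment _ _).segment_subset (left_mem_segment ℝ _ _) hq this
  have := (h.bend s).subset ⟨hx1, hx2⟩
  rw [Set.mem_singleton_iff, sub_eq_self, mul_eq_zero] at this
  rcases this with h0 | h0
  · have h0' : a = 0 := by exact_mod_cast h0
    have : b = 1 := by linarith
    subst this; subst h0'
    simp at he
    exact hq1 (by linear_combination he)
  · exact h.ne s 1 le_rfl (by omega) (by linear_combination h0)

lemma cT_bend (h : CPoly N z) (s : ℕ) :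
    cT z s = fang (z (s+1) - z s) (z (s+2) - z s) + fang (z (s+2) - z s) (z (s+2) - z (s+1)) := by
  have := fang_bend (h.zero_notMem s (right_mem_segment ℝ _ _) (h.ne (s+1) 1 le_rfl (by omega)))
  rw [show z (s+1) - z s + (z (s+1+1) - z (s+1)) = z (s+2) - z s by ring_nf] at this
  exact this

lemma cT_per (h : CPoly N z) (s : ℕ) : cT z (s + (N + 2)) = cT z s := by
  unfold cT
  rw [show s + (N+2) + 1 = (s+1) + (N+2) by ring, show s + (N+2) + 2 = (s+2) + (N+2) by ring,
    h.per, h.per, h.per]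

/-- plaquette sum from `s` along `[z s, q]`. -/
lemma adj_aux (a b : ℂ) (m : ℕ) : ∀ K : ℕ,
    (∀ j < K, Disjoint (segment ℝ a b) (segment ℝ (z (m + j)) (z (m + j + 1)))) →
    ∑ j ∈ Finset.range K, cA z a (m + j) + fang (z (m + K) - a) (z (m + K) - b)
      = fang (z m - a) (z m - b) + ∑ j ∈ Finset.range K, cA z b (m + j) := by
  intro K
  induction K with
  | zero => intro _; simp
  | succ K ih =>
    intro hK
    have i1 := ih (fun j hj => hK j (by omega))
    have i2 := fang_plaq (hK K (by omega))
    rw [Finset.sum_range_succ, Finset.sum_range_succ]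
    unfold cA at *
    rw [← add_assoc m K 1]
    linarith

lemma adj (h : CPoly N z) (s : ℕ) :
    cS N z s + cT z (s + N + 1) = cS N z (s + 1) + cT z s := by
  obtain ⟨M, rfl⟩ : ∃ M, N = M + 1 := ⟨N - 1, by have := h.hN; omega⟩
  have h1 := adj_aux (z := z) (z s) (z (s+1)) (s+2) M (by
    intro j hj
    have := h.disj s (2 + j) (by omega) (by omega)
    rwa [← add_assoc] at this)
  have h2 := h.cT_bend s
  have h3 := h.cT_bend (s + (M+1) + 1)
  have p0 := h.per s
  have p1 := h.per (s+1)
  unfold cS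
  rw [Finset.sum_range_succ', Finset.sum_range_succ]
  have e1 : ∀ p, ∀ j, cA z p (s+1+(j+1)) = cA z p (s+2+j) := by intro p j; congr 1; ring
  have e2 : ∀ p, ∀ j, cA z p (s+1+1+j) = cA z p (s+2+j) := by intro p j; congr 1
  simp only [e1, e2]
  rw [show s + (M+1) + 1 + 1 = s + (M+1+2) by ring, show s + (M+1) + 1 + 2 = s + 1 + (M+1+2) by ring, p0, p1] at h3
  have e3 : cA z (z s) (s+1+0) = fang (z (s+1) - z s) (z (s+2) - z s) := rfl
  have e4 : cA z (z (s+1)) (s+2+M) = fang (z (s+2+M) - z (s+1)) (z s - z (s+1)) := by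
    unfold cA; rw [← p0]; congr 3; ring
  rw [e3, e4, h2, h3]
  have e5 : fang (z s - z (s + (M+1) + 1)) (z (s+1) - z (s + (M+1) + 1)) = fang (z (s+2+M) - z s) (z (s+2+M) - z (s+1)) := by
    rw [← fang_neg_neg, neg_sub, neg_sub, show s + (M+1) + 1 = s + 2 + M by ring]
  have e6 : fang (z (s+1) - z (s + (M+1) + 1)) (z (s+1) - z s) = fang (z (s+2+M) - z (s+1)) (z s - z (s+1)) := by
    rw [← fang_neg_neg, neg_sub, neg_sub, show s + (M+1) + 1 = s + 2 + M by ring]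
  rw [e5, e6]
  linarith

/-- the constant `C`. -/
lemma const (h : CPoly N z) (s : ℕ) : cS N z s + cT z (s + N + 1) = cS N z 0 + cT z (N + 1) := by
  induction s with
  | zero => simp
  | succ s ih =>
    rw [← ih, h.adj s, show s + 1 + N + 1 = s + (N+2) by ring, h.cT_per]

lemma hopf_aux (h : CPoly N z) : ∀ m, m ≤ N →
    ∑ i ∈ Finset.range m, cT z i = ∑ j ∈ Finset.range m, cA z (z 0) (1 + j)
      + ∑ i ∈ Finset.range m, cA z (z (m+1)) i := by
  intro m
  induction m with
  | zero => simp
  | succ m ih =>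
    intro hm
    rw [Finset.sum_range_succ, ih (by omega), Finset.sum_range_succ (fun j => cA z (z 0) (1+j)),
      Finset.sum_range_succ (fun j => cA z (z (m+1+1)) j)]
    have h1 := adj_aux (z := z) (z (m+1)) (z (m+2)) 0 m (by
      intro j hj
      have := h.disj j (m + 1 - j) (by omega) (by omega)
      rw [show j + (m+1-j) = m+1 by omega] at this
      rw [zero_add]
      exact this.symm)
    have h2 := h.cT_bend m
    simp only [zero_add] at h1
    have e1 : cA z (z 0) (1+m) = fang (z 0 - z (m+1)) (z 0 - z (m+2)) := by
      unfold cA; rw [← fang_neg_neg, neg_sub, neg_sub]; congr 3 <;> ring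
    have e2 : cA z (z (m+2)) m = fang (z (m+2) - z m) (z (m+2) - z (m+1)) := by
      unfold cA; rw [← fang_neg_neg, neg_sub, neg_sub]
    have e3 : fang (z m - z (m+1)) (z m - z (m+2)) = fang (z (m+1) - z m) (z (m+2) - z m) := by
      rw [← fang_neg_neg, neg_sub, neg_sub]
    rw [show m + 1 + 1 = m + 2 by ring, e1, e2, h2]
    linarith

lemma hopf (h : CPoly N z) :
    ∑ i ∈ Finset.range (N+2), cT z i = 2 * (cS N z 0 + cT z (N + 1)) := by
  rw [Finset.sum_range_succ, Finset.sum_range_succ, h.hopf_aux N le_rfl]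
  have h1 := h.const (N+1)
  rw [show N + 1 + N + 1 = N + (N+2) by ring, h.cT_per] at h1
  have e1 : cS N z (N+1) = ∑ i ∈ Finset.range N, cA z (z (N+1)) i := by
    unfold cS
    apply Finset.sum_congr rfl
    intro j _
    unfold cA
    rw [show N + 1 + 1 + j = j + (N+2) by ring, show j + (N+2) + 1 = j + 1 + (N+2) by ring, h.per, h.per]
  have e2 : cS N z 0 = ∑ j ∈ Finset.range N, cA z (z 0) (1 + j) := by
    unfold cS; simp
  linarith

end CPoly

end

section
lemma fang_self_smul {a : ℂ} (ha : a ≠ 0) {c : ℝ} (hc : 0 ≤ c) : fang a (c * a) = 0 := by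
  unfold fang; rw [mul_div_assoc, div_self ha, mul_one]; exact Complex.arg_ofReal_of_nonneg hc

lemma fang_smul_right (a b : ℂ) {c : ℝ} (hc : 0 < c) : fang a (c * b) = fang a b := by
  unfold fang; rw [mul_div_assoc]; exact Complex.arg_real_mul _ hc

lemma fang_swap {x y : ℂ} (h0 : (0 : ℂ) ∉ segment ℝ x y) : fang y x = - fang x y := by
  have hx : x ≠ 0 := fun h => h0 (h ▸ left_mem_segment ℝ x y)
  unfold fang
  rw [← inv_div, Complex.arg_inv, if_neg]
  intro h
  rw [Complex.arg_eq_pi_iff] at h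
  obtain ⟨h1, h2⟩ := h
  apply h0
  set c := (y / x).re with hc
  have hy : y = (c : ℂ) * x := by
    have : y / x = (c : ℂ) := by apply Complex.ext <;> simp [hc, h2]
    rw [← this, div_mul_cancel₀ _ hx]
  refine ⟨-c/(1-c), 1/(1-c), ?_, ?_, ?_, ?_⟩
  · apply div_nonneg <;> linarith
  · apply div_nonneg <;> linarith
  · have : (1 - c) ≠ 0 := by linarith
    field_simp; ring
  · have : (1 - c : ℂ) ≠ 0 := by
      have : (1 - c) ≠ 0 := by linarith
      exact_mod_cast this
    simp only [Complex.real_smul]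
    push_cast
    rw [hy]; field_simp; ring

lemma fang_tri {x y : ℂ} (h0 : (0 : ℂ) ∉ segment ℝ x y) :
    fang x y + fang y (y - x) ≤ Real.pi ∧ -(fang x y + fang y (y - x)) < Real.pi := by
  by_cases h1 : (0 : ℂ) ∈ segment ℝ x (y - x)
  · have hx : x ≠ 0 := fun h => h0 (h ▸ left_mem_segment ℝ x y)
    obtain ⟨a, b, ha, hb, hab, he⟩ := h1
    simp only [Complex.real_smul] at he
    have hb0 : 0 < b := by
      rcases hb.lt_or_eq with h | h
      · exact h
      · exfalso; have : a = 1 := by linarith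
        subst this; rw [← h] at he; simp at he; exact hx he
    have hba : 0 < b - a := by
      by_contra hcon
      push Not at hcon
      apply h0
      have ha0 : 0 < a := by linarith
      refine ⟨(a - b)/a, b/a, div_nonneg (by linarith) ha, div_nonneg hb ha, by field_simp; ring, ?_⟩
      have : (a : ℂ) ≠ 0 := by exact_mod_cast ha0.ne'
      simp only [Complex.real_smul]
      push_cast
      field_simp
      linear_combination he
    have hy : y = ((b - a)/b : ℝ) * x := by
      have : (b : ℂ) ≠ 0 := by exact_mod_cast hb0.ne'
      push_cast; field_simp; linear_combination he
    have : fang x y = 0 := by rw [hy]; exact fang_self_smul hx (by positivity)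
    rw [this]
    have := fang_le y (y - x)
    have := fang_gt y (y - x)
    constructor <;> linarith
  · have := fang_bend h1
    rw [show x + (y - x) = y by ring] at this
    rw [← this]
    have := fang_le x (y - x)
    have := fang_gt x (y - x)
    constructor <;> linarith

/-- total angle around `p` -/
noncomputable def cW (N : ℕ) (z : ℕ → ℂ) (p : ℂ) : ℝ := ∑ j ∈ Finset.range (N+2), cA z p j

lemma sum_cA_coe (z : ℕ → ℂ) (p : ℂ) (s : ℕ) : ∀ K, (∀ j ≤ K, z (s + j) ≠ p) →
    ((∑ j ∈ Finset.range K, cA z p (s + j) : ℝ) : Real.Angle)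
      = (Complex.arg (z (s + K) - p) : Real.Angle) - (Complex.arg (z s - p) : Real.Angle) := by
  intro K
  induction K with
  | zero => intro _; simp
  | succ K ih =>
    intro hK
    rw [Finset.sum_range_succ, Real.Angle.coe_add, ih (fun j hj => hK j (by omega))]
    unfold cA
    rw [add_assoc s K 1, fang_coe (sub_ne_zero.2 (hK K (by omega))) (sub_ne_zero.2 (hK (K+1) (by omega)))]
    abel

namespace CPoly
variable {N : ℕ} {z : ℕ → ℂ}

lemma cA_per (h : CPoly N z) (p : ℂ) (s : ℕ) : cA z p (s + (N + 2)) = cA z p s := by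
  unfold cA
  rw [show s + (N+2) + 1 = (s+1) + (N+2) by ring, h.per, h.per]

lemma z_mod (h : CPoly N z) (i : ℕ) : z i = z (i % (N+2)) := by
  have : Function.Periodic z (N+2) := h.per
  exact (this.map_mod_nat i).symm

lemma cW_shift (h : CPoly N z) (p : ℂ) (s : ℕ) :
    cW N z p = ∑ j ∈ Finset.range (N+2), cA z p (s + j) := by
  induction s with
  | zero => simp [cW]
  | succ s ih =>
    rw [ih, Finset.sum_range_succ', Finset.sum_range_succ (fun j => cA z p (s+1+j))]
    rw [show s + 1 + (N+1) = s + (N+2) by ring, h.cA_per]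
    simp only [add_zero]
    congr 1
    apply Finset.sum_congr rfl
    intro j _
    congr 1; ring

lemma cW_int (h : CPoly N z) (p : ℂ) (hp : ∀ i, z i ≠ p) : ∃ a : ℤ, cW N z p = 2 * Real.pi * a := by
  have h1 := sum_cA_coe z p 0 (N+2) (fun j _ => hp _)
  simp only [zero_add] at h1
  have h2 := h.per 0
  rw [zero_add] at h2
  rw [h2, sub_self] at h1
  obtain ⟨a, ha⟩ := Real.Angle.angle_eq_iff_two_pi_dvd_sub.1 (h1.trans (Real.Angle.coe_zero).symm)
  exact ⟨a, by unfold cW; linarith⟩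

lemma C_int (h : CPoly N z) : ∃ a : ℤ, cS N z 0 + cT z (N+1) = Real.pi + 2 * Real.pi * a := by
  have hN := h.hN
  have h1 := sum_cA_coe z (z 0) 1 N (fun j hj => by
    have := h.ne 0 (1+j) (by omega) (by omega); rwa [zero_add] at this)
  have p0 := h.per 0
  have p1 := h.per 1
  rw [zero_add] at p0
  have n1 : z 1 - z 0 ≠ 0 := sub_ne_zero.2 (by have := h.ne 0 1 le_rfl (by omega); simpa using this)
  have n2 : z (N+1) - z 0 ≠ 0 := sub_ne_zero.2 (by have := h.ne 0 (N+1) (by omega) (by omega); simpa using this)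
  have n3 : z 0 - z (N+1) ≠ 0 := by rw [← neg_sub]; exact neg_ne_zero.2 n2
  have h2 : ((cT z (N+1) : ℝ) : Real.Angle) = (Complex.arg (z 1 - z 0) : Real.Angle) - (Complex.arg (z 0 - z (N+1)) : Real.Angle) := by
    unfold cT
    rw [show N + 1 + 1 = N + 2 by ring, show N + 1 + 2 = 1 + (N+2) by ring, p0, p1, fang_coe n3 n1]
  have h3 : ((cS N z 0 + cT z (N+1) : ℝ) : Real.Angle) = (Real.pi : Real.Angle) := by
    rw [Real.Angle.coe_add, h2]
    unfold cS
    rw [zero_add, h1, show z 0 - z (N+1) = -(z (N+1) - z 0) by ring, Complex.arg_neg_coe_angle n2, add_comm 1 N, ← Real.Angle.neg_coe_pi]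
    rw [Real.Angle.neg_coe_pi]
    have := Real.Angle.neg_coe_pi
    calc _ = -(Real.pi : Real.Angle) := by abel
      _ = _ := this
  obtain ⟨a, ha⟩ := Real.Angle.angle_eq_iff_two_pi_dvd_sub.1 h3
  exact ⟨a, by linarith⟩

lemma open_edge (h : CPoly N z) (s : ℕ) {q : ℂ} (hq : q ∈ segment ℝ (z s) (z (s+1)))
    (h0 : q ≠ z s) (h1 : q ≠ z (s+1)) :
    ∑ j ∈ Finset.range (N+1), cA z q (s+1+j) = cS N z 0 + cT z (N+1) := by
  have d1 : Disjoint (segment ℝ (z s) q) (segment ℝ (z (s+1)) (z (s+2))) := by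
    rw [Set.disjoint_left]
    intro x hx1 hx2
    have hx3 := (convex_segment _ _).segment_subset (left_mem_segment ℝ _ _) hq hx1
    have hx := (h.bend s).subset ⟨hx3, hx2⟩
    rw [Set.mem_singleton_iff] at hx
    subst hx
    rw [segment_eq_image'] at hx1 hq
    obtain ⟨t, ⟨ht0, ht1⟩, ht⟩ := hx1
    obtain ⟨u, ⟨hu0, hu1⟩, hu⟩ := hq
    simp only [Complex.real_smul] at ht hu
    have e : (z (s+1) - z s) * (1 - t * u) = 0 := by
      linear_combination -ht - t * hu
    rcases mul_eq_zero.1 e with e | e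
    · exact h.ne s 1 le_rfl (by omega) (by linear_combination e)
    · have e' : t * u = 1 := by
        have : (t * u : ℂ) = 1 := by linear_combination -e
        exact_mod_cast this
      have : u = 1 := by nlinarith
      rw [this] at hu
      apply h1; rw [← hu]; push_cast; ring
  have a1 := adj_aux (z := z) (z s) q (s+1) N (by
    intro j hj
    rcases Nat.eq_zero_or_pos j with rfl | hj0
    · exact d1
    · have := h.disj s (1 + j) (by omega) (by omega)
      rw [← add_assoc] at this
      exact this.mono_left ((convex_segment _ _).segment_subset (left_mem_segment ℝ _ _) hq))
  have p0 := h.per s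
  have p1 := h.per (s+1)
  obtain ⟨u, ⟨hu0, hu1⟩, hu⟩ := (segment_eq_image' ℝ (z s) (z (s+1))).subset hq
  simp only [Complex.real_smul] at hu
  have hu0' : 0 < u := by
    rcases hu0.lt_or_eq with h | h
    · exact h
    · exfalso; apply h0; rw [← hu, ← h]; simp
  have nz : z (s+1) - z s ≠ 0 := sub_ne_zero.2 (h.ne s 1 le_rfl (by omega))
  have e1 : fang (z (s+1) - z s) (z (s+1) - q) = 0 := by
    rw [show z (s+1) - q = ((1 - u : ℝ) : ℂ) * (z (s+1) - z s) by push_cast; linear_combination hu]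
    exact fang_self_smul nz (by linarith)
  have e2 : cT z (s+N+1) = fang (z s - z (s+N+1)) (q - z s) := by
    unfold cT
    rw [show s+N+1+1 = s + (N+2) by ring, show s + N+1+2 = s + 1 + (N+2) by ring, p0, p1,
      show q - z s = (u : ℂ) * (z (s+1) - z s) by linear_combination -hu, fang_smul_right _ _ hu0']
  have hb := fang_bend (h.zero_notMem (s+N+1) (q := q) (by
    rw [show s+N+1+1 = s + (N+2) by ring, show s + N+1+2 = s + 1 + (N+2) by ring, p0, p1]; exact hq) (by
    rw [show s+N+1+1 = s + (N+2) by ring, p0]; exact h0))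
  rw [show s+N+1+1 = s + (N+2) by ring, p0, show z s - z (s+N+1) + (q - z s) = q - z (s+N+1) by ring] at hb
  have e3 : fang (z s - z (s+N+1)) (q - z (s+N+1)) = fang (z (s+1+N) - z s) (z (s+1+N) - q) := by
    rw [← fang_neg_neg, neg_sub, neg_sub, show s+1+N = s+N+1 by ring]
  have e4 : fang (q - z (s+N+1)) (q - z s) = cA z q (s+1+N) := by
    unfold cA
    rw [← fang_neg_neg, neg_sub, neg_sub, show s+1+N+1 = s + (N+2) by ring, p0, show s+1+N = s+N+1 by ring]
  have hc := h.const s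
  rw [Finset.sum_range_succ]
  unfold cS at hc ⊢
  linarith

lemma W_lt_aux_open (h : CPoly N z) (s : ℕ) {p q : ℂ} (hq : q ∈ segment ℝ (z s) (z (s+1)))
    (h0 : q ≠ z s) (h1 : q ≠ z (s+1))
    (hd : ∀ i, q ∉ segment ℝ (z i) (z (i+1)) → Disjoint (segment ℝ p q) (segment ℝ (z i) (z (i+1)))) :
    cW N z p < cS N z 0 + cT z (N+1) + 3 * Real.pi := by
  have p0 := h.per s
  have p1 := h.per (s+1)
  have a1 := adj_aux (z := z) p q (s+1) (N+1) (by
    intro j hj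
    apply hd
    intro hqj
    rcases Nat.eq_zero_or_pos j with rfl | hj0
    · exact h1 ((h.bend s).subset ⟨hq, hqj⟩)
    rcases Nat.lt_or_ge j N with hjN | hjN
    · have := h.disj s (1 + j) (by omega) (by omega)
      rw [← add_assoc] at this
      exact Set.disjoint_left.1 this hq hqj
    · obtain rfl : j = N := by omega
      apply h0
      have := (h.bend (s+1+j)).subset ⟨hqj, by
        rw [show s+1+j+1 = s + (j+2) by ring, show s +1+ j+2 = s + 1 + (j+2) by ring, p0, p1]; exact hq⟩
      rw [show s+1+j+1 = s + (j+2) by ring, p0] at this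
      exact this)
  rw [h.open_edge s hq h0 h1] at a1
  rw [h.cW_shift p (s+1), Finset.sum_range_succ]
  have := fang_gt (z (s + 1 + (N + 1)) - p) (z (s + 1 + (N + 1)) - q)
  have := fang_le (z (s + 1) - p) (z (s + 1) - q)
  have : cA z p (s + 1 + (N + 1)) ≤ Real.pi := fang_le _ _
  linarith

lemma W_lt_aux_vtx (h : CPoly N z) (s : ℕ) {p : ℂ}
    (hp : ∀ i, p ∉ segment ℝ (z i) (z (i+1)))
    (hd : ∀ i, z s ∉ segment ℝ (z i) (z (i+1)) → Disjoint (segment ℝ p (z s)) (segment ℝ (z i) (z (i+1)))) :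
    cW N z p < cS N z 0 + cT z (N+1) + 3 * Real.pi := by
  have p0 := h.per s
  have p1 := h.per (s+1)
  have a1 := adj_aux (z := z) p (z s) (s+1) N (by
    intro j hj
    apply hd
    intro hqj
    rcases Nat.eq_zero_or_pos j with rfl | hj0
    · have := (h.bend s).subset ⟨left_mem_segment ℝ _ _, hqj⟩
      exact h.ne s 1 le_rfl (by omega) this.symm
    · have := h.disj s (1 + j) (by omega) (by omega)
      rw [← add_assoc] at this
      exact Set.disjoint_left.1 this (left_mem_segment ℝ _ _) hqj)
  have tr : ∀ a b : ℂ, (0 : ℂ) ∈ segment ℝ (a - p) (b - p) → p ∈ segment ℝ a b := by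
    rintro a b ⟨u, v, hu, hv, huv, he⟩
    refine ⟨u, v, hu, hv, huv, ?_⟩
    simp only [Complex.real_smul] at he ⊢
    have : (u + v : ℂ) = 1 := by exact_mod_cast huv
    linear_combination he + p * this
  have t1 := fang_tri (x := z s - p) (y := z (s+1) - p) (fun h => hp s (tr _ _ h))
  have n2 : (0 : ℂ) ∉ segment ℝ (z s - p) (z (s+1+N) - p) := fun hh => by
    apply hp (s+1+N)
    rw [show s+1+N+1 = s + (N+2) by ring, p0, segment_symm]
    exact tr _ _ hh
  have t2 := fang_tri n2
  have t3 := fang_swap n2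
  rw [show z (s+1) - p - (z s - p) = z (s+1) - z s by ring] at t1
  rw [show z (s+1+N) - p - (z s - p) = z (s+1+N) - z s by ring] at t2
  have e1 : cA z p (s+1+(N+1)) = fang (z s - p) (z (s+1) - p) := by
    rw [show s+1+(N+1) = s + (N+2) by ring, h.cA_per]; rfl
  have e2 : cA z p (s+1+N) = fang (z (s+1+N) - p) (z s - p) := by
    unfold cA; rw [show s+1+N+1 = s + (N+2) by ring, p0]
  have hc := h.const s
  have hT : - Real.pi < cT z (s+N+1) := fang_gt _ _
  rw [h.cW_shift p (s+1), Finset.sum_range_succ, Finset.sum_range_succ, e1, e2]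
  unfold cS at hc ⊢
  linarith [t1.1, t2.2]

lemma W_lt (h : CPoly N z) {p : ℂ} (hp : ∀ i, p ∉ segment ℝ (z i) (z (i+1))) :
    cW N z p < cS N z 0 + cT z (N+1) + 3 * Real.pi := by
  set K : Set ℂ := ⋃ i ∈ Finset.range (N+2), segment ℝ (z i) (z (i+1)) with hK
  have cK : IsCompact K := by
    apply Finset.isCompact_biUnion
    intro i _
    rw [← convexHull_pair (𝕜 := ℝ)]
    exact (Set.toFinite _).isCompact_convexHull (𝕜 := ℝ)
  have mem : ∀ i x, x ∈ segment ℝ (z i) (z (i+1)) → x ∈ K := by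
    intro i x hx
    rw [hK, Set.mem_iUnion₂]
    refine ⟨i % (N+2), Finset.mem_range.2 (Nat.mod_lt _ (by omega)), ?_⟩
    rw [← h.z_mod]
    have : z (i+1) = z (i % (N+2) + 1) := by
      rw [h.z_mod (i+1), h.z_mod (i % (N+2) + 1)]; congr 1; simp [Nat.add_mod]
    rwa [← this]
  obtain ⟨q, hq, hd⟩ := cK.exists_infDist_eq_dist ⟨z 0, mem 0 _ (left_mem_segment ℝ _ _)⟩ p
  have hmin : ∀ x ∈ K, dist p q ≤ dist p x := fun x hx => hd ▸ Metric.infDist_le_dist_of_mem hx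
  have hdis : ∀ i, q ∉ segment ℝ (z i) (z (i+1)) → Disjoint (segment ℝ p q) (segment ℝ (z i) (z (i+1))) := by
    intro i hi
    rw [Set.disjoint_left]
    intro x hx hxi
    apply hi
    have h1 := hmin x (mem i x hxi)
    have h2 := dist_add_dist_of_mem_segment hx
    have : dist x q = 0 := le_antisymm (by linarith) dist_nonneg
    rw [dist_eq_zero] at this
    rwa [← this]
  rw [hK, Set.mem_iUnion₂] at hq
  obtain ⟨i, _, hi⟩ := hq
  by_cases h0 : q = z i
  · subst h0; exact h.W_lt_aux_vtx i hp hdis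
  by_cases h1 : q = z (i+1)
  · subst h1; exact h.W_lt_aux_vtx (i+1) hp hdis
  exact h.W_lt_aux_open i hi h0 h1 hdis

lemma C_ge (h : CPoly N z) {p : ℂ} (hp : ∀ i, p ∉ segment ℝ (z i) (z (i+1))) (hW : 0 < cW N z p) :
    Real.pi ≤ cS N z 0 + cT z (N+1) := by
  have h1 := h.W_lt hp
  obtain ⟨a, ha⟩ := h.cW_int p (fun i hi => hp i (hi ▸ left_mem_segment ℝ _ _))
  obtain ⟨b, hb⟩ := h.C_int
  have hpi := Real.pi_pos
  rw [ha] at h1 hW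
  rw [hb] at h1 ⊢
  have ha1 : (0:ℝ) < a := by nlinarith
  have ha2 : 0 < a := by exact_mod_cast ha1
  have h3 : (a : ℝ) < b + 2 := by nlinarith
  have h4 : a < b + 2 := by exact_mod_cast h3
  have : (0:ℝ) ≤ b := by exact_mod_cast (by omega : 0 ≤ b)
  nlinarith

end CPoly

end

section
open MeasureTheory

/-- cross product on the complex plane -/
def ccr (a b : ℂ) : ℝ := a.re * b.im - a.im * b.re

lemma fang_pos_of {x y : ℂ} (h : 0 < ccr x y) : 0 < fang x y ∧ fang x y < Real.pi := by
  have hx : x ≠ 0 := by rintro rfl; simp [ccr] at h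
  have hi : 0 < (y / x).im := by
    have : (y / x).im = ccr x y / Complex.normSq x := by rw [Complex.div_im]; unfold ccr; ring
    rw [this]; exact div_pos h (Complex.normSq_pos.2 hx)
  unfold fang
  constructor
  · apply lt_of_le_of_ne (Complex.arg_nonneg_iff.2 hi.le)
    intro h0
    have := (Complex.arg_eq_zero_iff.1 h0.symm).2
    linarith
  · exact Complex.arg_lt_pi_iff.2 (Or.inr hi.ne')

lemma fang_neg_of {x y : ℂ} (h : ccr x y < 0) : fang x y < 0 := by
  have hx : x ≠ 0 := by rintro rfl; simp [ccr] at h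
  have hi : (y / x).im < 0 := by
    have : (y / x).im = ccr x y / Complex.normSq x := by rw [Complex.div_im]; unfold ccr; ring
    rw [this]; exact div_neg_of_neg_of_pos h (Complex.normSq_pos.2 hx)
  exact Complex.arg_neg_iff.2 hi

lemma fang_self' {x : ℂ} (hx : x ≠ 0) : fang x x = 0 := by
  unfold fang; rw [div_self hx, Complex.arg_one]

/-- generic pair -/
def GenP (x y : ℂ) : Prop := x ≠ 0 ∧ y ≠ 0 ∧ (x = y ∨ ccr x y ≠ 0)

lemma GenP.symm {x y : ℂ} (h : GenP x y) : GenP y x := by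
  obtain ⟨h1, h2, h3⟩ := h
  refine ⟨h2, h1, ?_⟩
  rcases h3 with h3 | h3
  · exact Or.inl h3.symm
  · right; intro h4; apply h3; unfold ccr at *; linarith

lemma GenP.lt_pi {x y : ℂ} (h : GenP x y) : fang x y < Real.pi := by
  obtain ⟨h1, h2, rfl | h3⟩ := h
  · rw [fang_self' h1]; exact Real.pi_pos
  · rcases lt_or_gt_of_ne h3 with h4 | h4
    · exact (fang_neg_of h4).trans Real.pi_pos
    · exact (fang_pos_of h4).2

lemma GenP.le_zero {x y : ℂ} (h : GenP x y) (h' : ¬ 0 < ccr x y) : fang x y ≤ 0 := by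
  obtain ⟨h1, h2, rfl | h3⟩ := h
  · rw [fang_self' h1]
  · exact (fang_neg_of (lt_of_le_of_ne (not_lt.1 h') h3)).le

lemma GenP.ge_zero {x y : ℂ} (h : GenP x y) (h' : ¬ ccr x y < 0) : 0 ≤ fang x y := by
  obtain ⟨h1, h2, rfl | h3⟩ := h
  · rw [fang_self' h1]
  · exact (fang_pos_of (lt_of_le_of_ne (not_lt.1 h') h3.symm)).1.le

lemma GenP.swap {x y : ℂ} (h : GenP x y) : fang y x = - fang x y := by
  have := h.lt_pi
  unfold fang at *
  rw [← inv_div, Complex.arg_inv, if_neg this.ne]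

/-- open triangle, positively oriented -/
def PosT (b c : ℂ) : Set ℂ := {q | 0 < ccr (-q) (b - q) ∧ 0 < ccr (b - q) (c - q) ∧ 0 < ccr (c - q) (-q)}

lemma mem_PosT_swap {b c q : ℂ} : q ∈ PosT c b ↔
    (ccr (-q) (b - q) < 0 ∧ ccr (b - q) (c - q) < 0 ∧ ccr (c - q) (-q) < 0) := by
  have e : ∀ x y : ℂ, ccr x y = - ccr y x := by intro x y; unfold ccr; ring
  unfold PosT
  simp only [Set.mem_ofPred_eq]
  rw [e (-q) (c - q), e (c - q) (b - q), e (b - q) (-q)]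
  simp only [Left.neg_pos_iff]
  tauto

open Classical in
lemma tri_formula {b c q : ℂ} (h1 : GenP (-q) (b - q)) (h2 : GenP (b - q) (c - q)) (h3 : GenP (c - q) (-q)) :
    fang (-q) (b - q) + fang (b - q) (c - q) + fang (c - q) (-q)
      = 2 * Real.pi * ((PosT b c).indicator 1 q - (PosT c b).indicator 1 q) := by
  have hpi := Real.pi_pos
  obtain ⟨a, ha⟩ : ∃ a : ℤ, fang (-q) (b - q) + fang (b - q) (c - q) + fang (c - q) (-q) = 2 * Real.pi * a := by
    have : ((fang (-q) (b - q) + fang (b - q) (c - q) + fang (c - q) (-q) : ℝ) : Real.Angle) = ((0 : ℝ) : Real.Angle) := by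
      rw [Real.Angle.coe_add, Real.Angle.coe_add, fang_coe h1.1 h1.2.1, fang_coe h2.1 h2.2.1, fang_coe h3.1 h3.2.1]
      rw [Real.Angle.coe_zero]; abel
    obtain ⟨a, ha⟩ := Real.Angle.angle_eq_iff_two_pi_dvd_sub.1 this
    exact ⟨a, by linarith⟩
  have l1 := h1.lt_pi
  have l2 := h2.lt_pi
  have l3 := h3.lt_pi
  have g1 := fang_gt (-q) (b-q)
  have g2 := fang_gt (b-q) (c-q)
  have g3 := fang_gt (c-q) (-q)
  rw [ha]
  by_cases hP : q ∈ PosT b c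
  · have hN : q ∉ PosT c b := by
      rw [mem_PosT_swap]; intro h; have := hP.1; linarith [h.1]
    rw [Set.indicator_of_mem hP, Set.indicator_of_notMem hN]
    have s1 := (fang_pos_of hP.1).1
    have s2 := (fang_pos_of hP.2.1).1
    have s3 := (fang_pos_of hP.2.2).1
    have : (0:ℝ) < a := by nlinarith
    have : (a:ℝ) < 2 := by nlinarith
    have : a = 1 := by
      have h1 : 0 < a := by assumption_mod_cast
      have h2 : a < 2 := by assumption_mod_cast
      omega
    subst this; simp
  · rw [Set.indicator_of_notMem hP]
    by_cases hN : q ∈ PosT c b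
    · rw [Set.indicator_of_mem hN]
      rw [mem_PosT_swap] at hN
      have s1 := fang_neg_of hN.1
      have s2 := fang_neg_of hN.2.1
      have s3 := fang_neg_of hN.2.2
      have : (a:ℝ) < 0 := by nlinarith
      have : (-2:ℝ) < a := by nlinarith
      have : a = -1 := by
        have h1 : a < 0 := by assumption_mod_cast
        have h2 : -2 < a := by assumption_mod_cast
        omega
      subst this; simp
    · rw [Set.indicator_of_notMem hN]
      rw [mem_PosT_swap] at hN
      have u : fang (-q) (b - q) + fang (b - q) (c - q) + fang (c - q) (-q) < 2 * Real.pi := by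
        by_cases k1 : 0 < ccr (-q) (b-q)
        · by_cases k2 : 0 < ccr (b-q) (c-q)
          · by_cases k3 : 0 < ccr (c-q) (-q)
            · exact absurd ⟨k1, k2, k3⟩ hP
            · linarith [h3.le_zero k3]
          · linarith [h2.le_zero k2]
        · linarith [h1.le_zero k1]
      have l : - (2 * Real.pi) < fang (-q) (b - q) + fang (b - q) (c - q) + fang (c - q) (-q) := by
        by_cases k1 : ccr (-q) (b-q) < 0
        · by_cases k2 : ccr (b-q) (c-q) < 0
          · by_cases k3 : ccr (c-q) (-q) < 0
            · exact absurd ⟨k1, k2, k3⟩ hN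
            · linarith [h3.ge_zero k3]
          · linarith [h2.ge_zero k2]
        · linarith [h1.ge_zero k1]
      have : (a:ℝ) < 1 := by nlinarith
      have : (-1:ℝ) < a := by nlinarith
      have : a = 0 := by
        have h1 : a < 1 := by assumption_mod_cast
        have h2 : -1 < a := by assumption_mod_cast
        omega
      subst this; simp

lemma ae_generic {a b : ℂ} (hab : a ≠ b) : ∀ᵐ q : ℂ, ccr (a - q) (b - q) ≠ 0 := by
  set d := b - a with hd
  have hd0 : d ≠ 0 := sub_ne_zero.2 hab.symm
  let f : ℂ →ₗ[ℝ] ℝ := d.im • Complex.reLm - d.re • Complex.imLm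
  have hf : ∀ w, f w = d.im * w.re - d.re * w.im := fun w => by simp [f]
  have h1 : LinearMap.ker f ≠ ⊤ := by
    intro h
    have : d * Complex.I ∈ LinearMap.ker f := by rw [h]; trivial
    rw [LinearMap.mem_ker, hf] at this
    simp at this
    apply hd0
    apply Complex.ext
    · simp; nlinarith [sq_nonneg d.re, sq_nonneg d.im]
    · simp; nlinarith [sq_nonneg d.re, sq_nonneg d.im]
  have h2 := Measure.addHaar_submodule (volume : Measure ℂ) _ h1
  have h3 : volume ((fun q : ℂ => q + (-a)) ⁻¹' (LinearMap.ker f : Set ℂ)) = 0 := by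
    rw [measure_preimage_add_right]; exact h2
  rw [ae_iff]
  refine measure_mono_null ?_ h3
  intro q hq
  simp only [ne_eq, not_not, Set.mem_ofPred_eq] at hq
  simp only [Set.mem_preimage, SetLike.mem_coe, LinearMap.mem_ker, hf, hd]
  unfold ccr at hq
  simp at hq ⊢
  linarith

lemma ae_ne' (a : ℂ) : ∀ᵐ q : ℂ, a - q ≠ 0 := by
  rw [ae_iff]
  refine measure_mono_null (t := {a}) ?_ (by simp)
  intro q hq
  simp only [ne_eq, not_not, Set.mem_ofPred_eq] at hq
  simp; linear_combination -hq

lemma ae_GenP (a b : ℂ) : ∀ᵐ q : ℂ, GenP (a - q) (b - q) := by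
  by_cases hab : a = b
  · subst hab
    filter_upwards [ae_ne' a] with q hq
    exact ⟨hq, hq, Or.inl rfl⟩
  · filter_upwards [ae_ne' a, ae_ne' b, ae_generic hab] with q h1 h2 h3
    exact ⟨h1, h2, Or.inr h3⟩

/-- standard open triangle -/
def stdT : Set ℂ := {w | 0 < w.re ∧ 0 < w.im ∧ w.re + w.im < 1}

lemma stdT_open : IsOpen stdT := by
  have h1 : IsOpen {w : ℂ | 0 < w.re} := isOpen_lt (by fun_prop) (by fun_prop)
  have h2 : IsOpen {w : ℂ | 0 < w.im} := isOpen_lt (by fun_prop) (by fun_prop)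
  have h3 : IsOpen {w : ℂ | w.re + w.im < 1} := isOpen_lt (by fun_prop) (by fun_prop)
  exact h1.inter (h2.inter h3)

lemma stdT_pos : 0 < volume stdT := by
  apply stdT_open.measure_pos (μ := volume)
  exact ⟨⟨1/4, 1/4⟩, by norm_num [stdT]⟩

lemma stdT_lt_top : volume stdT < ⊤ := by
  have : Bornology.IsBounded stdT := by
    rw [isBounded_iff_forall_norm_le]
    refine ⟨2, fun w hw => ?_⟩
    obtain ⟨h1, h2, h3⟩ := hw
    have := Complex.norm_le_abs_re_add_abs_im w
    rw [abs_of_pos h1, abs_of_pos h2] at this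
    linarith
  exact this.measure_lt_top

lemma PosT_open (b c : ℂ) : IsOpen (PosT b c) := by
  have h1 : IsOpen {q : ℂ | 0 < ccr (-q) (b - q)} := by
    unfold ccr; exact isOpen_lt (by fun_prop) (by fun_prop)
  have h2 : IsOpen {q : ℂ | 0 < ccr (b - q) (c - q)} := by
    unfold ccr; exact isOpen_lt (by fun_prop) (by fun_prop)
  have h3 : IsOpen {q : ℂ | 0 < ccr (c - q) (-q)} := by
    unfold ccr; exact isOpen_lt (by fun_prop) (by fun_prop)
  exact h1.inter (h2.inter h3)

lemma vol_PosT (b c : ℂ) : volume (PosT b c) = ENNReal.ofReal (ccr b c) * volume stdT := by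
  rcases lt_or_ge 0 (ccr b c) with hD | hD
  · let A : ℂ →ₗ[ℝ] ℂ := Complex.reLm.smulRight b + Complex.imLm.smulRight c
    have hA : ∀ w, A w = w.re * b + w.im * c := fun w => by simp [A]
    have hdet : LinearMap.det A = ccr b c := by
      rw [← LinearMap.det_toMatrix Complex.basisOneI, Matrix.det_fin_two]
      simp [LinearMap.toMatrix_apply, hA, ccr]
      ring
    have himg : A '' stdT = PosT b c := by
      ext q
      constructor
      · rintro ⟨w, ⟨h1, h2, h3⟩, rfl⟩
        rw [hA]
        unfold ccr at hD
        refine ⟨?_, ?_, ?_⟩ <;> unfold ccr <;> simp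
        · nlinarith [mul_pos h2 hD]
        · nlinarith [mul_pos (sub_pos.2 h3) hD]
        · nlinarith [mul_pos h1 hD]
      · rintro ⟨h1, h2, h3⟩
        refine ⟨⟨ccr q c / ccr b c, ccr b q / ccr b c⟩, ⟨?_, ?_, ?_⟩, ?_⟩
        · apply div_pos _ hD; unfold ccr at *; simp at h3; simp; linarith
        · apply div_pos _ hD; unfold ccr at *; simp at h1; simp; linarith
        · simp only
          rw [← add_div, div_lt_one hD]; unfold ccr at *; simp at h2; linarith
        · rw [hA]
          have := hD.ne'
          apply Complex.ext
          · simp; field_simp; unfold ccr; ring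
          · simp; field_simp; unfold ccr; ring
    rw [← himg, Measure.addHaar_image_linearMap, hdet, abs_of_pos hD]
  · rw [ENNReal.ofReal_of_nonpos hD, zero_mul]
    have : PosT b c = ∅ := by
      ext q
      simp only [Set.mem_empty_iff_false, iff_false]
      rintro ⟨h1, h2, h3⟩
      unfold ccr at *; simp at h1 h2 h3; linarith
    rw [this]; simp

lemma area_sum_le {n : ℕ} {z : ℕ → ℂ} (hn : z n = z 0)
    (h : ∀ᵐ q : ℂ, ∑ j ∈ Finset.range n, cA z q j ≤ 0) :
    ∑ j ∈ Finset.range n, ccr (z j) (z (j+1)) ≤ 0 := by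
  set κ := (volume stdT).toReal with hκ
  have hκ0 : 0 < κ := ENNReal.toReal_pos stdT_pos.ne' stdT_lt_top.ne
  let F : ℕ → ℂ → ℝ := fun j q => (PosT (z j) (z (j+1))).indicator 1 q - (PosT (z (j+1)) (z j)).indicator 1 q
  have hfin : ∀ b c, volume (PosT b c) ≠ ⊤ := fun b c => by
    rw [vol_PosT]; exact ENNReal.mul_ne_top ENNReal.ofReal_ne_top stdT_lt_top.ne
  have hint : ∀ b c, Integrable ((PosT b c).indicator (1 : ℂ → ℝ)) := fun b c => by
    rw [integrable_indicator_iff (PosT_open b c).measurableSet]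
    exact integrableOn_const (hfin b c)
  have hval : ∀ b c, ∫ q, (PosT b c).indicator (1 : ℂ → ℝ) q = max (ccr b c) 0 * κ := fun b c => by
    rw [integral_indicator_one (PosT_open b c).measurableSet]
    unfold Measure.real
    rw [vol_PosT, ENNReal.toReal_mul, ENNReal.toReal_ofReal']
  have hF : ∀ j, ∫ q, F j q = ccr (z j) (z (j+1)) * κ := fun j => by
    simp only [F]
    rw [integral_sub (hint _ _) (hint _ _), hval, hval]
    have : ccr (z (j+1)) (z j) = - ccr (z j) (z (j+1)) := by unfold ccr; ring
    rw [this]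
    rcases le_total 0 (ccr (z j) (z (j+1))) with h | h
    · rw [max_eq_left h, max_eq_right (by linarith)]; ring
    · rw [max_eq_right h, max_eq_left (by linarith)]; ring
  have hae : ∀ᵐ q : ℂ, ∑ j ∈ Finset.range n, F j q ≤ 0 := by
    have g1 : ∀ᵐ q : ℂ, ∀ j, GenP (z j - q) (z (j+1) - q) := ae_all_iff.2 (fun j => ae_GenP _ _)
    have g2 : ∀ᵐ q : ℂ, ∀ j, GenP (0 - q) (z j - q) := ae_all_iff.2 (fun j => ae_GenP _ _)
    filter_upwards [h, g1, g2] with q hq k1 k2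
    simp only [zero_sub] at k2
    have e : ∀ j, 2 * Real.pi * F j q = cA z q j + (fang (-q) (z j - q) - fang (-q) (z (j+1) - q)) := by
      intro j
      simp only [F]
      rw [← tri_formula (k2 j) (k1 j) (k2 (j+1)).symm, (k2 (j+1)).swap]
      unfold cA; ring
    have e2 : 2 * Real.pi * ∑ j ∈ Finset.range n, F j q = ∑ j ∈ Finset.range n, cA z q j := by
      rw [Finset.mul_sum, Finset.sum_congr rfl (fun j _ => e j), Finset.sum_add_distrib,
        Finset.sum_range_sub', hn, sub_self, add_zero]
    have := Real.pi_pos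
    by_contra hcon
    push Not at hcon
    have : 0 < 2 * Real.pi * ∑ j ∈ Finset.range n, F j q := by positivity
    linarith
  have h1 : ∫ q, ∑ j ∈ Finset.range n, F j q ≤ 0 := integral_nonpos_of_ae hae
  have hFi : ∀ j ∈ Finset.range n, Integrable (F j) := fun j _ => (hint _ _).sub (hint _ _)
  rw [integral_finsetSum _ hFi] at h1
  simp only [hF] at h1
  rw [← Finset.sum_mul] at h1
  by_contra hcon
  push Not at hcon
  have := mul_pos hcon hκ0
  linarith

lemma CPoly.turn_ge {N : ℕ} {z : ℕ → ℂ} (h : CPoly N z)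
    (harea : 0 < ∑ j ∈ Finset.range (N+2), ccr (z j) (z (j+1))) :
    Real.pi ≤ cS N z 0 + cT z (N+1) := by
  by_contra hcon
  have key : ∀ p, (∀ i, p ∉ segment ℝ (z i) (z (i+1))) → cW N z p ≤ 0 := by
    intro p hp
    by_contra h1
    exact hcon (h.C_ge hp (not_le.1 h1))
  have p0 := h.per 0
  rw [zero_add] at p0
  have := area_sum_le p0 (by
    have g1 : ∀ᵐ q : ℂ, ∀ j, GenP (z j - q) (z (j+1) - q) := ae_all_iff.2 (fun j => ae_GenP _ _)
    filter_upwards [g1] with q hq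
    apply key
    rintro i ⟨u, v, hu, hv, huv, he⟩
    obtain ⟨_, _, h3 | h3⟩ := hq i
    · exact h.ne i 1 le_rfl (by omega) (by linear_combination -h3)
    · apply h3
      have : u = 1 - v := by linarith
      subst this
      rw [← he]
      unfold ccr; simp; ring)
  linarith

end

section
lemma fang_of_ccr_zero {x y : ℂ} (h : ccr x y = 0) : fang x y = 0 ∨ fang x y = Real.pi := by
  have hi : (y / x).im = 0 := by
    have : (y / x).im = ccr x y / Complex.normSq x := by rw [Complex.div_im]; unfold ccr; ring
    rw [this, h, zero_div]
  unfold fang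
  rcases le_or_gt 0 (y/x).re with h1 | h1
  · left; exact Complex.arg_eq_zero_iff.2 ⟨h1, hi⟩
  · right; exact Complex.arg_eq_pi_iff.2 ⟨h1, hi⟩

lemma fang_nonpos_of {x y : ℂ} (h : ccr x y ≤ 0) (h0 : (0 : ℂ) ∉ segment ℝ x y) : fang x y ≤ 0 := by
  rcases h.lt_or_eq with h | h
  · exact (fang_neg_of h).le
  · rcases fang_of_ccr_zero h with h1 | h1
    · exact h1.le
    · exfalso
      have := fang_swap h0
      have := fang_gt y x
      linarith

lemma ccr_pos_of_fang {x y : ℂ} (h1 : 0 < fang x y) (h2 : fang x y < Real.pi) : 0 < ccr x y := by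
  rcases lt_trichotomy (ccr x y) 0 with h | h | h
  · linarith [fang_neg_of h]
  · rcases fang_of_ccr_zero h with h | h <;> linarith
  · exact h

lemma ccr_neg_of_fang {x y : ℂ} (h1 : fang x y < 0) : ccr x y < 0 := by
  rcases lt_trichotomy (ccr x y) 0 with h | h | h
  · exact h
  · rcases fang_of_ccr_zero h with h | h <;> linarith [Real.pi_pos]
  · linarith [(fang_pos_of h).1]

namespace CPoly
variable {N : ℕ} {z : ℕ → ℂ}

lemma dir_coe (h : CPoly N z) (m : ℕ) :
    ((∑ i ∈ Finset.range m, cT z i : ℝ) : Real.Angle) =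
      (fang (z 1 - z 0) (z (m+1) - z m) : Real.Angle) := by
  have hne : ∀ s, z (s+1) - z s ≠ 0 := fun s => sub_ne_zero.2 (h.ne s 1 le_rfl (by omega))
  have h0 := hne 0
  rw [zero_add] at h0
  rw [fang_coe h0 (hne m)]
  induction m with
  | zero => simp
  | succ m ih =>
    rw [Finset.sum_range_succ, Real.Angle.coe_add, ih]
    unfold cT
    rw [fang_coe (hne m) (hne (m+1))]
    rw [show m + 2 = m+1+1 by ring]
    abel

lemma directions (h : CPoly N z) (hC : Real.pi ≤ cS N z 0 + cT z (N+1))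
    (k : ℕ) (hk1 : 1 ≤ k) (hk2 : k ≤ N)
    (hneg : ∀ s, 1 ≤ s → s ≤ N → s ≠ k → ccr (z (s+1) - z s) (z (s+2) - z (s+1)) ≤ 0)
    (hpos : ∀ s, s = 0 ∨ s = k ∨ s = N+1 → 0 < ccr (z (s+1) - z s) (z (s+2) - z (s+1))) :
    (∀ m, 1 ≤ m → m ≤ k → 0 < ccr (z 1 - z 0) (z (m+1) - z m)) ∧
    (∀ m, k+1 ≤ m → m ≤ N+1 → ccr (z 1 - z 0) (z (m+1) - z m) < 0) := by
  set S : ℕ → ℝ := fun m => ∑ i ∈ Finset.range m, cT z i with hS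
  have hstep : ∀ m, S (m+1) = S m + cT z m := fun m => Finset.sum_range_succ _ _
  have hT : ∀ s, 1 ≤ s → s ≤ N → s ≠ k → cT z s ≤ 0 := by
    intro s h1 h2 h3
    exact fang_nonpos_of (hneg s h1 h2 h3)
      (h.zero_notMem s (right_mem_segment ℝ _ _) (h.ne (s+1) 1 le_rfl (by omega)))
  have p0 : cT z 0 < Real.pi := (fang_pos_of (hpos 0 (Or.inl rfl))).2
  have pk : cT z k < Real.pi := (fang_pos_of (hpos k (Or.inr (Or.inl rfl)))).2
  have pN : cT z (N+1) < Real.pi := (fang_pos_of (hpos (N+1) (Or.inr (Or.inr rfl)))).2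
  have hpi := Real.pi_pos
  have hanti1 : ∀ a b, 1 ≤ a → a ≤ b → b ≤ k → S b ≤ S a := by
    intro a b ha hab
    induction b, hab using Nat.le_induction with
    | base => intro _; exact le_rfl
    | succ b hb ih =>
      intro hbk
      rw [hstep]
      have := ih (by omega)
      have := hT b (by omega) (by omega) (by omega)
      linarith
  have hanti2 : ∀ a b, k+1 ≤ a → a ≤ b → b ≤ N+1 → S b ≤ S a := by
    intro a b ha hab
    induction b, hab using Nat.le_induction with
    | base => intro _; exact le_rfl
    | succ b hb ih =>
      intro hbk
      rw [hstep]
      have := ih (by omega)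
      have := hT b (by omega) (by omega) (by omega)
      linarith
  have s1 : S 1 = cT z 0 := by simp [hS]
  have stot : S (N+2) = 2 * (cS N z 0 + cT z (N+1)) := h.hopf
  have sN := hstep (N+1)
  have sk := hstep k
  obtain ⟨a, ha⟩ := h.C_int
  constructor
  · intro m h1 h2
    have b1 := hanti1 1 m le_rfl h1 h2
    have b2 := hanti1 m k h1 h2 le_rfl
    have b3 := hanti2 (k+1) (N+1) le_rfl (by omega) le_rfl
    have l1 : S m < Real.pi := by linarith
    have l2 : 0 < S m := by
      rw [show N+1+1 = N+2 by ring] at sN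
      linarith
    have e := h.dir_coe m
    obtain ⟨c, hc⟩ := Real.Angle.angle_eq_iff_two_pi_dvd_sub.1 e
    change S m - _ = _ at hc
    have g := fang_gt (z 1 - z 0) (z (m+1) - z m)
    have g' := fang_le (z 1 - z 0) (z (m+1) - z m)
    have c1 : (c:ℝ) < 1 := by nlinarith
    have c2 : (-1:ℝ) < c := by nlinarith
    have : c = 0 := by
      have h1 : c < 1 := by exact_mod_cast c1
      have h2 : -1 < c := by exact_mod_cast c2
      omega
    subst this
    simp at hc
    apply ccr_pos_of_fang <;> linarith
  · intro m h1 h2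
    have b1 := hanti2 (k+1) m le_rfl h1 h2
    have b2 := hanti2 m (N+1) h1 h2 le_rfl
    have b3 := hanti1 1 k le_rfl hk1 le_rfl
    rw [show N+1+1 = N+2 by ring] at sN
    have e := h.dir_coe m
    obtain ⟨c, hc⟩ := Real.Angle.angle_eq_iff_two_pi_dvd_sub.1 e
    change S m - _ = _ at hc
    have g := fang_gt (z 1 - z 0) (z (m+1) - z m)
    have g' := fang_le (z 1 - z 0) (z (m+1) - z m)
    have l1 : S m < 2 * (Real.pi + 2 * Real.pi * a) := by linarith
    have l2 : 2 * (Real.pi + 2 * Real.pi * a) - Real.pi < S m := by linarith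
    have c1 : (c:ℝ) < 1 + 2 * a + 1 := by nlinarith
    have c2 : (2 * a + 1 - 1 : ℝ) < c := by nlinarith
    have : c = 1 + 2 * a := by
      have h1 : c < 1 + 2 * a + 1 := by exact_mod_cast c1
      have h2 : 2 * a + 1 - 1 < c := by exact_mod_cast c2
      omega
    subst this
    push_cast at hc
    apply ccr_neg_of_fang; linarith

end CPoly

end

section
open SimplePolygon

lemma cross2_add_right (a b c : ℝ × ℝ) : cross2 a (b + c) = cross2 a b + cross2 a c := by
  simp [cross2]; ring
lemma cross2_sub_right (a b c : ℝ × ℝ) : cross2 a (b - c) = cross2 a b - cross2 a c := by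
  simp [cross2]; ring
lemma cross2_smul_right (t : ℝ) (a b : ℝ × ℝ) : cross2 a (t • b) = t * cross2 a b := by
  simp [cross2]; ring
lemma cross2_self (a : ℝ × ℝ) : cross2 a a = 0 := by simp [cross2]; ring
lemma cross2_anti (a b : ℝ × ℝ) : cross2 a b = - cross2 b a := by simp [cross2]; ring
lemma cross2_neg_left (a b : ℝ × ℝ) : cross2 (-a) b = - cross2 a b := by simp [cross2]; ring
lemma cross2_neg_right (a b : ℝ × ℝ) : cross2 a (-b) = - cross2 a b := by simp [cross2]; ring
lemma cross2_star (a b c d : ℝ × ℝ) :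
    cross2 a b * cross2 d c + cross2 b c * cross2 d a + cross2 c a * cross2 d b = 0 := by
  simp [cross2]; ring

lemma cross2_cont (a c : ℝ × ℝ) : Continuous (fun x => cross2 a (x - c)) := by
  unfold cross2; fun_prop

/-- affine functional values on a segment point -/
lemma cross2_comb (a c x y : ℝ × ℝ) {s t : ℝ} (h : s + t = 1) :
    cross2 a (s • x + t • y - c) = s * cross2 a (x - c) + t * cross2 a (y - c) := by
  obtain rfl : s = 1 - t := by linarith
  simp [cross2]; ring

lemma cross2_zero_imp {B v : ℝ × ℝ} (hB : B ≠ 0) (h : cross2 B v = 0) : ∃ s : ℝ, v = s • B := by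
  unfold cross2 at h
  by_cases h1 : B.1 = 0
  · have h2 : B.2 ≠ 0 := fun h2 => hB (Prod.ext h1 h2)
    refine ⟨v.2 / B.2, ?_⟩
    ext
    · simp [h1] at h ⊢; tauto
    · simp; field_simp
  · refine ⟨v.1 / B.1, ?_⟩
    ext
    · simp; field_simp
    · simp; field_simp; linarith

/-- edge functional -/
def gch (w : ℕ → ℝ × ℝ) (m : ℕ) (x : ℝ × ℝ) : ℝ := cross2 (w (m+1) - w m) (x - w m)

lemma gch_add_smul (w : ℕ → ℝ × ℝ) (m : ℕ) (x B : ℝ × ℝ) (s : ℝ) :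
    gch w m (x + s • B) = gch w m x - s * cross2 B (w (m+1) - w m) := by
  unfold gch
  rw [add_sub_right_comm, cross2_add_right, cross2_smul_right, cross2_anti _ B]; ring

lemma gch_comb (w : ℕ → ℝ × ℝ) (m : ℕ) (x y : ℝ × ℝ) {s t : ℝ} (h : s + t = 1) :
    gch w m (s • x + t • y) = s * gch w m x + t * gch w m y := cross2_comb _ _ _ _ h

/-- A reflex chain ascending with respect to `B`. -/
structure Chain (B : ℝ × ℝ) (K : ℕ) (w : ℕ → ℝ × ℝ) : Prop where
  hK : 1 ≤ K
  up : ∀ m < K, 0 < cross2 B (w (m+1) - w m)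
  turn : ∀ m, m + 1 < K → cross2 (w (m+1) - w m) (w (m+2) - w (m+1)) ≤ 0

/-- the forbidden convex set beyond a chain -/
def chC (K : ℕ) (w : ℕ → ℝ × ℝ) : Set (ℝ × ℝ) := {x | ∀ m < K, gch w m x < 0}

/-- points of the chain -/
def chP (K : ℕ) (w : ℕ → ℝ × ℝ) : Set (ℝ × ℝ) := {x | ∃ m < K, x ∈ segment ℝ (w m) (w (m+1))}

lemma chC_open (K : ℕ) (w : ℕ → ℝ × ℝ) : IsOpen (chC K w) := by
  have : chC K w = ⋂ m ∈ Finset.range K, {x | gch w m x < 0} := by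
    ext x; simp [chC]
  rw [this]
  exact isOpen_biInter_finset (fun m _ => isOpen_lt (cross2_cont _ _) continuous_const)

lemma chC_convex (K : ℕ) (w : ℕ → ℝ × ℝ) : Convex ℝ (chC K w) := by
  intro x hx y hy a b ha hb hab m hm
  rw [gch_comb _ _ _ _ hab]
  have h1 := hx m hm
  have h2 := hy m hm
  rcases ha.lt_or_eq with ha | ha
  · nlinarith [mul_pos_of_neg_of_neg h1 (by linarith : -a < 0), mul_nonneg hb (by linarith : 0 ≤ - gch w m y)]
  · have : b = 1 := by linarith
    subst this; rw [← ha]; linarith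

namespace Chain
variable {B : ℝ × ℝ} {K : ℕ} {w : ℕ → ℝ × ℝ}

lemma B_ne (h : Chain B K w) : B ≠ 0 := by
  rintro rfl
  have := h.up 0 h.hK
  simp [cross2] at this

lemma slope (h : Chain B K w) (i j : ℕ) (hij : i ≤ j) (hj : j < K) :
    cross2 (w (i+1) - w i) (w (j+1) - w j) ≤ 0 := by
  induction j, hij using Nat.le_induction with
  | base => rw [cross2_self]
  | succ j hj' ih =>
    have i1 := ih (by omega)
    have i2 := h.turn j hj
    have st := cross2_star (w (i+1) - w i) (w (j+1) - w j) (w (j+2) - w (j+1)) B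
    have u1 := h.up i (by omega)
    have u2 := h.up j (by omega)
    have u3 := h.up (j+1) hj
    rw [cross2_anti (w (j+2) - w (j+1))] at st
    by_contra hcon
    push Not at hcon
    rw [show j + 1 + 1 = j + 2 by ring] at hcon u3
    nlinarith [mul_pos hcon u2, mul_nonneg (neg_nonneg.2 i1) u3.le, mul_nonneg (neg_nonneg.2 i2) u1.le]

lemma g_vtx (h : Chain B K w) (m t : ℕ) (hm : m < K) (ht : t ≤ K) : gch w m (w t) ≤ 0 := by
  rcases le_total m t with hmt | hmt
  · induction t, hmt using Nat.le_induction with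
    | base => simp [gch, cross2]
    | succ t ht' ih =>
      have i1 := ih (by omega)
      have i2 := h.slope m t ht' (by omega)
      unfold gch at *
      rw [show w (t+1) - w m = (w t - w m) + (w (t+1) - w t) by abel, cross2_add_right]
      linarith
  · obtain ⟨d, rfl⟩ := Nat.exists_eq_add_of_le hmt
    clear hmt
    induction d generalizing t with
    | zero => simp [gch, cross2]
    | succ d ih =>
      have i1 := ih (t+1) (by omega) (by omega)
      have i2 := h.slope t (t+(d+1)) (by omega) (by omega)
      rw [show t + 1 + d = t + (d+1) by ring] at i1
      unfold gch at *
      rw [show w t - w (t+(d+1)) = (w (t+1) - w (t+(d+1))) - (w (t+1) - w t) by abel, cross2_sub_right,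
        cross2_anti _ (w (t+1) - w t)]
      linarith

lemma g_chain (h : Chain B K w) {x : ℝ × ℝ} (hx : x ∈ chP K w) (m : ℕ) (hm : m < K) : gch w m x ≤ 0 := by
  obtain ⟨j, hj, a, b, ha, hb, hab, rfl⟩ := hx
  rw [gch_comb _ _ _ _ hab]
  have := h.g_vtx m j hm (by omega)
  have := h.g_vtx m (j+1) hm (by omega)
  nlinarith

lemma chain_notMem {x : ℝ × ℝ} (hx : x ∈ chP K w) : x ∉ chC K w := by
  obtain ⟨j, hj, a, b, ha, hb, hab, rfl⟩ := hx
  intro hC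
  have := hC j hj
  rw [gch_comb _ _ _ _ hab] at this
  simp [gch, cross2] at this
  nlinarith

lemma mono (h : Chain B K w) (i j : ℕ) (hij : i ≤ j) (hj : j ≤ K) (c : ℝ × ℝ) :
    cross2 B (w i - c) ≤ cross2 B (w j - c) := by
  induction j, hij using Nat.le_induction with
  | base => exact le_rfl
  | succ j hj' ih =>
    have := ih (by omega)
    have := h.up j (by omega)
    rw [show w (j+1) - c = (w j - c) + (w (j+1) - w j) by abel, cross2_add_right]
    linarith

lemma range (h : Chain B K w) {x : ℝ × ℝ} (hx : x ∈ chP K w) (c : ℝ × ℝ) :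
    cross2 B (w 0 - c) ≤ cross2 B (x - c) ∧ cross2 B (x - c) ≤ cross2 B (w K - c) := by
  obtain ⟨j, hj, a, b, ha, hb, hab, rfl⟩ := hx
  rw [cross2_comb _ _ _ _ hab]
  have h1 := h.mono 0 j (by omega) (by omega) c
  have h2 := h.mono 0 (j+1) (by omega) (by omega) c
  have h3 := h.mono j K (by omega) (by omega) c
  have h4 := h.mono (j+1) K (by omega) (by omega) c
  obtain rfl : a = 1 - b := by linarith
  constructor
  · nlinarith [mul_nonneg ha (sub_nonneg.2 h1), mul_nonneg hb (sub_nonneg.2 h2)]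
  · nlinarith [mul_nonneg ha (sub_nonneg.2 h3), mul_nonneg hb (sub_nonneg.2 h4)]

lemma exists_height (h : Chain B K w) (c : ℝ × ℝ) (t : ℝ) (h0 : cross2 B (w 0 - c) ≤ t)
    (h1 : t ≤ cross2 B (w K - c)) : ∃ y ∈ chP K w, cross2 B (y - c) = t := by
  have aux : ∀ J, 1 ≤ J → J ≤ K → t ≤ cross2 B (w J - c) → ∃ m < K, cross2 B (w m - c) ≤ t ∧ t ≤ cross2 B (w (m+1) - c) := by
    intro J hJ
    induction J, hJ using Nat.le_induction with
    | base => intro hK ht; exact ⟨0, by omega, h0, ht⟩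
    | succ J hJ ih =>
      intro hK ht
      rcases le_total t (cross2 B (w J - c)) with h2 | h2
      · exact ih (by omega) h2
      · exact ⟨J, by omega, h2, ht⟩
  obtain ⟨m, hm, ha, hb⟩ := aux K h.hK le_rfl h1
  have hu := h.up m hm
  have e : cross2 B (w (m+1) - c) = cross2 B (w m - c) + cross2 B (w (m+1) - w m) := by
    rw [← cross2_add_right]; congr 1; abel
  set d := cross2 B (w (m+1) - w m)
  set s := (t - cross2 B (w m - c)) / d
  have hs : s * d = t - cross2 B (w m - c) := by simp only [s]; field_simp
  refine ⟨(1 - s) • w m + s • w (m+1), ⟨m, hm, 1 - s, s, ?_, ?_, by ring, rfl⟩, ?_⟩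
  · by_contra hc; push Not at hc; nlinarith
  · exact div_nonneg (by linarith) hu.le
  · rw [cross2_comb _ _ _ _ (by ring)]; rw [e]; linarith

lemma side (h : Chain B K w) {x y : ℝ × ℝ} (hy : ∀ m < K, gch w m y ≤ 0) (hx : x ∉ chC K w) {s : ℝ}
    (e : x = y + s • B) : s ≤ 0 := by
  unfold chC at hx
  simp only [Set.mem_ofPred_eq, not_forall, not_lt] at hx
  obtain ⟨m, hm, hg⟩ := hx
  rw [e, gch_add_smul] at hg
  have := hy m hm
  have := h.up m hm
  by_contra hc; push Not at hc
  nlinarith [mul_pos hc this]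

lemma side' (h : Chain B K w) {x y : ℝ × ℝ} (hy : ∀ m < K, gch w m y ≤ 0) (hx : x ∉ chC K w)
    (e : cross2 B (x - y) = 0) : ∃ s : ℝ, s ≤ 0 ∧ x = y + s • B := by
  obtain ⟨s, hs⟩ := cross2_zero_imp h.B_ne e
  have e : x = y + s • B := by rw [← hs]; abel
  exact ⟨s, h.side hy hx e, e⟩

lemma on_chain (h : Chain B K w) {x : ℝ × ℝ} (c : ℝ × ℝ) (h0 : cross2 B (w 0 - c) ≤ cross2 B (x - c))
    (h1 : cross2 B (x - c) ≤ cross2 B (w K - c)) (hx : ∀ m < K, gch w m x ≤ 0) (hC : x ∉ chC K w) :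
    x ∈ chP K w := by
  obtain ⟨y, hy, e⟩ := h.exists_height c _ h0 h1
  obtain ⟨s, hs, e2⟩ := h.side' (h.g_chain hy) hC (by
    rw [show x - y = (x - c) - (y - c) by abel, cross2_sub_right]; linarith)
  have := h.side (s := -s) hx (chain_notMem hy) (by rw [e2]; simp)
  have : s = 0 := by linarith
  subst this
  simp at e2
  rwa [e2]

lemma add_mem (h : Chain B K w) {x : ℝ × ℝ} (hx : x ∈ chC K w) {s : ℝ} (hs : 0 ≤ s) : x + s • B ∈ chC K w := by
  intro m hm
  rw [gch_add_smul]
  have := hx m hm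
  have := h.up m hm
  nlinarith [mul_nonneg hs this.le]

end Chain

end

section
open SimplePolygon

/-- Abstract funnel: left chain `w` (ascending) and right chain `v` (descending). -/
structure Fnl (B : ℝ × ℝ) (k K : ℕ) (w v : ℕ → ℝ × ℝ) : Prop where
  L : Chain B k w
  R : Chain (-B) K v
  top : w k = v 0
  bot : w 0 = v K + B
  apex : 0 < cross2 (w k - w (k-1)) (v 1 - v 0)

/-- boundary of the abstract funnel -/
def fB (k K : ℕ) (w v : ℕ → ℝ × ℝ) : Set (ℝ × ℝ) := segment ℝ (v K) (w 0) ∪ (chP k w ∪ chP K v)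

/-- the region of the abstract funnel -/
def fF (B : ℝ × ℝ) (k K : ℕ) (w v : ℕ → ℝ × ℝ) : Set (ℝ × ℝ) :=
  {x | 0 ≤ cross2 B (x - v K) ∧ cross2 B (x - v K) ≤ cross2 B (v 0 - v K) ∧ x ∉ chC k w ∧ x ∉ chC K v}

lemma not_bdd_of_ray {D S : Set (ℝ × ℝ)} (hD : Convex ℝ D) (hDS : D ⊆ Sᶜ) {p d : ℝ × ℝ} (hd : d ≠ 0)
    (hray : ∀ s : ℝ, 0 ≤ s → p + s • d ∈ D) : ¬ Bornology.IsBounded (connectedComponentIn Sᶜ p) := by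
  intro hb
  have hpD : p ∈ D := by simpa using hray 0 le_rfl
  have h1 := hD.isPreconnected.subset_connectedComponentIn hpD hDS
  have h2 := hb.subset h1
  rw [isBounded_iff_forall_norm_le] at h2
  obtain ⟨C, hC⟩ := h2
  have hd' : 0 < ‖d‖ := norm_pos_iff.2 hd
  have hC0 : 0 ≤ C := (norm_nonneg _).trans (hC p hpD)
  have h3 := hC _ (hray ((C + ‖p‖ + 1) / ‖d‖) (by positivity))
  have h4 : ‖((C + ‖p‖ + 1) / ‖d‖) • d‖ = C + ‖p‖ + 1 := by
    rw [norm_smul, Real.norm_of_nonneg (by positivity)]; field_simp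
  have h5 := norm_sub_le (p + ((C + ‖p‖ + 1) / ‖d‖) • d) p
  rw [add_sub_cancel_left, h4] at h5
  linarith

namespace Fnl
variable {B : ℝ × ℝ} {k K : ℕ} {w v : ℕ → ℝ × ℝ}

lemma sep (h : Fnl B k K w v) : ∃ a b : ℝ, 0 < a ∧ 0 < b ∧ ∃ c : ℝ, 0 < c ∧ ∀ x,
    gch v 0 x * a + gch w (k-1) x * b = c * (cross2 B (v 0 - v K) - cross2 B (x - v K)) := by
  have hk := h.L.hK
  have u1 := h.L.up (k-1) (by omega)
  have u2 := h.R.up 0 h.R.hK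
  rw [show k - 1 + 1 = k by omega] at u1
  rw [cross2_neg_left] at u2
  refine ⟨_, _, u1, u2, _, h.apex, fun x => ?_⟩
  unfold gch
  rw [show k - 1 + 1 = k by omega, zero_add]
  have t := h.top
  rw [t]
  simp [cross2]
  ring

lemma sep_L (h : Fnl B k K w v) {x : ℝ × ℝ} (hx : cross2 B (x - v K) ≤ cross2 B (v 0 - v K)) (hg : gch v 0 x < 0) :
    0 < gch w (k-1) x := by
  obtain ⟨a, b, ha, hb, c, hc, e⟩ := h.sep
  have := e x
  by_contra hcon
  push Not at hcon
  nlinarith [mul_nonneg hc.le (sub_nonneg.2 hx), mul_pos_of_neg_of_neg hg (neg_lt_zero.2 ha), mul_nonneg (neg_nonneg.2 hcon) hb.le]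

lemma sep_R (h : Fnl B k K w v) {x : ℝ × ℝ} (hx : cross2 B (x - v K) ≤ cross2 B (v 0 - v K)) (hg : gch w (k-1) x < 0) :
    0 < gch v 0 x := by
  obtain ⟨a, b, ha, hb, c, hc, e⟩ := h.sep
  have := e x
  by_contra hcon
  push Not at hcon
  nlinarith [mul_nonneg hc.le (sub_nonneg.2 hx), mul_pos_of_neg_of_neg hg (neg_lt_zero.2 hb), mul_nonneg (neg_nonneg.2 hcon) ha.le]

lemma Y_w0 (h : Fnl B k K w v) : cross2 B (w 0 - v K) = 0 := by
  rw [h.bot]; simp [cross2]; ring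

lemma rangeL (h : Fnl B k K w v) {x : ℝ × ℝ} (hx : x ∈ chP k w) :
    0 ≤ cross2 B (x - v K) ∧ cross2 B (x - v K) ≤ cross2 B (v 0 - v K) := by
  have := h.L.range hx (v K)
  rwa [h.Y_w0, h.top] at this

lemma rangeR (h : Fnl B k K w v) {x : ℝ × ℝ} (hx : x ∈ chP K v) :
    0 ≤ cross2 B (x - v K) ∧ cross2 B (x - v K) ≤ cross2 B (v 0 - v K) := by
  have := h.R.range hx (v K)
  simp only [cross2_neg_left, sub_self] at this
  have e : cross2 B 0 = 0 := by simp [cross2]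
  rw [e] at this
  constructor <;> linarith [this.1, this.2]

lemma bdry_sub (h : Fnl B k K w v) : fB k K w v ⊆ fF B k K w v := by
  have hk := h.L.hK
  have hK := h.R.hK
  rintro x (hx | hx | hx)
  · obtain ⟨a, b, ha, hb, hab, rfl⟩ := hx
    have hY : cross2 B (a • v K + b • w 0 - v K) = 0 := by
      rw [cross2_comb _ _ _ _ hab, h.Y_w0]; simp [cross2]
    have hH : 0 ≤ cross2 B (v 0 - v K) := by
      have := h.L.mono 0 k (by omega) le_rfl (v K)
      rwa [h.Y_w0, h.top] at this
    refine ⟨hY.ge, by rw [hY]; exact hH, fun hC => ?_, fun hC => ?_⟩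
    · have := hC 0 hk
      have e : a • v K + b • w 0 = w 0 + (-a) • B := by
        rw [h.bot]; obtain rfl : a = 1 - b := by linarith
        ext <;> simp <;> ring
      rw [e, gch_add_smul] at this
      have u := h.L.up 0 hk
      have : gch w 0 (w 0) = 0 := by simp [gch, cross2]
      nlinarith [mul_nonneg ha u.le]
    · have := hC (K-1) (by omega)
      have e : a • v K + b • w 0 = v K + (-b) • (-B) := by
        rw [h.bot]; obtain rfl : a = 1 - b := by linarith
        ext <;> simp <;> ring
      rw [e, gch_add_smul] at this
      have u := h.R.up (K-1) (by omega)
      have : gch v (K-1) (v K) = 0 := by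
        unfold gch; rw [show K - 1 + 1 = K by omega, cross2_self]
      nlinarith [mul_nonneg hb u.le]
  · refine ⟨(h.rangeL hx).1, (h.rangeL hx).2, Chain.chain_notMem hx, fun hC => ?_⟩
    have h1 := h.sep_L (h.rangeL hx).2 (hC 0 hK)
    have h2 := h.L.g_chain hx (k-1) (by omega)
    linarith
  · refine ⟨(h.rangeR hx).1, (h.rangeR hx).2, fun hC => ?_, Chain.chain_notMem hx⟩
    have h1 := h.sep_R (h.rangeR hx).2 (hC (k-1) (by omega))
    have h2 := h.R.g_chain hx 0 hK
    linarith

lemma F_closed (B : ℝ × ℝ) (k K : ℕ) (w v : ℕ → ℝ × ℝ) : IsClosed (fF B k K w v) := by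
  have h1 : IsClosed {x | 0 ≤ cross2 B (x - v K)} := isClosed_le continuous_const (cross2_cont _ _)
  have h2 : IsClosed {x | cross2 B (x - v K) ≤ cross2 B (v 0 - v K)} := isClosed_le (cross2_cont _ _) continuous_const
  exact h1.inter (h2.inter ((chC_open k w).isClosed_compl.inter (chC_open K v).isClosed_compl))

/-- the open interior candidate -/
def fU (B : ℝ × ℝ) (k K : ℕ) (w v : ℕ → ℝ × ℝ) : Set (ℝ × ℝ) :=
  {x | 0 < cross2 B (x - v K) ∧ cross2 B (x - v K) < cross2 B (v 0 - v K) ∧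
    (∃ m < k, 0 < gch w m x) ∧ (∃ m < K, 0 < gch v m x)}

lemma U_open (B : ℝ × ℝ) (k K : ℕ) (w v : ℕ → ℝ × ℝ) : IsOpen (fU B k K w v) := by
  have h1 : IsOpen {x | 0 < cross2 B (x - v K)} := isOpen_lt continuous_const (cross2_cont _ _)
  have h2 : IsOpen {x | cross2 B (x - v K) < cross2 B (v 0 - v K)} := isOpen_lt (cross2_cont _ _) continuous_const
  have h3 : ∀ (n : ℕ) (a : ℕ → ℝ × ℝ), IsOpen {x | ∃ m < n, 0 < gch a m x} := by
    intro n a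
    have : {x | ∃ m < n, 0 < gch a m x} = ⋃ m ∈ Finset.range n, {x | 0 < gch a m x} := by
      ext x; simp
    rw [this]
    exact isOpen_biUnion (fun m _ => isOpen_lt continuous_const (cross2_cont _ _))
  exact h1.inter (h2.inter ((h3 k w).inter (h3 K v)))

lemma U_sub_F : fU B k K w v ⊆ fF B k K w v := by
  rintro x ⟨h1, h2, ⟨m, hm, hg⟩, ⟨j, hj, hg'⟩⟩
  exact ⟨h1.le, h2.le, fun hC => by linarith [hC m hm], fun hC => by linarith [hC j hj]⟩

/-- horizontal sandwich -/
lemma sandwich (h : Fnl B k K w v) {x y y' : ℝ × ℝ} (hx : x ∈ fF B k K w v)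
    (hy : ∀ m < k, gch w m y ≤ 0) (hy' : ∀ m < K, gch v m y' ≤ 0)
    (e : cross2 B (y - v K) = cross2 B (x - v K)) (e' : cross2 B (y' - v K) = cross2 B (x - v K)) :
    x ∈ segment ℝ y' y := by
  obtain ⟨_, _, h3, h4⟩ := hx
  obtain ⟨s, hs, es⟩ := h.L.side' hy h3 (by
    rw [show x - y = (x - v K) - (y - v K) by abel, cross2_sub_right]; linarith)
  obtain ⟨t, ht, et⟩ := h.R.side' hy' h4 (by
    rw [show x - y' = (x - v K) - (y' - v K) by abel, cross2_neg_left, cross2_sub_right]; linarith)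
  rcases eq_or_lt_of_le (add_nonpos hs ht) with h0 | h0
  · have h1 : s = 0 := by linarith
    subst h1
    simp at es
    rw [es]; exact right_mem_segment ℝ _ _
  · have h1 : s + t ≠ 0 := h0.ne
    refine ⟨s/(s+t), t/(s+t), div_nonneg_of_nonpos hs h0.le, div_nonneg_of_nonpos ht h0.le, by field_simp, ?_⟩
    have e1 : y' = x + t • B := by rw [et]; simp
    have e2 : y = x - s • B := by rw [es]; simp
    rw [e1, e2]
    ext <;> simp <;> field_simp <;> ring

lemma F_sub_U (h : Fnl B k K w v) {x : ℝ × ℝ} (hx : x ∈ fF B k K w v) (hxb : x ∉ fB k K w v) : x ∈ fU B k K w v := by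
  have hk := h.L.hK
  have hK := h.R.hK
  have zz : cross2 B (v K - v K) = 0 := by simp [cross2]
  have hx' := hx
  obtain ⟨h1, h2, h3, h4⟩ := hx
  refine ⟨lt_of_le_of_ne h1 fun he => hxb ?_, lt_of_le_of_ne h2 fun he => hxb ?_, ?_, ?_⟩
  · left
    exact h.sandwich hx' (fun m hm => h.L.g_vtx m 0 hm (by omega)) (fun m hm => h.R.g_vtx m K hm le_rfl)
      (by rw [h.Y_w0, he]) (by rw [← he]; exact zz)
  · have := h.sandwich hx' (fun m hm => h.L.g_vtx m k hm le_rfl) (fun m hm => h.R.g_vtx m 0 hm (by omega))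
      (by rw [h.top, he]) (by rw [he])
    rw [h.top, segment_same] at this
    rw [Set.mem_singleton_iff.1 this]
    right; right
    exact ⟨0, hK, left_mem_segment ℝ _ _⟩
  · by_contra hcon
    push Not at hcon
    apply hxb; right; left
    exact h.L.on_chain (v K) (by rw [h.Y_w0]; exact h1) (by rw [h.top]; exact h2) hcon h3
  · by_contra hcon
    push Not at hcon
    apply hxb; right; right
    exact h.R.on_chain (v K) (by rw [cross2_neg_left, cross2_neg_left]; linarith)
      (by rw [cross2_neg_left, cross2_neg_left, zz]; linarith) hcon h4

lemma fB_bounded (k K : ℕ) (w v : ℕ → ℝ × ℝ) : Bornology.IsBounded (fB k K w v) := by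
  have hs : ∀ a b : ℝ × ℝ, Bornology.IsBounded (segment ℝ a b) := fun a b => by
    rw [← convexHull_pair (𝕜 := ℝ)]
    exact ((Set.toFinite _).isCompact_convexHull (𝕜 := ℝ)).isBounded
  have hc : ∀ (n : ℕ) (a : ℕ → ℝ × ℝ), Bornology.IsBounded (chP n a) := by
    intro n a
    have : chP n a = ⋃ m ∈ Finset.range n, segment ℝ (a m) (a (m+1)) := by
      ext x; simp [chP]
    rw [this, Bornology.isBounded_biUnion_finset]
    exact fun m _ => hs _ _
  exact (hs _ _).union ((hc _ _).union (hc _ _))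

lemma F_bounded (h : Fnl B k K w v) : Bornology.IsBounded (fF B k K w v) := by
  have zz : cross2 B (v K - v K) = 0 := by simp [cross2]
  refine (isBounded_convexHull.2 (fB_bounded k K w v)).subset ?_
  intro x hx
  obtain ⟨y, hy, e⟩ := h.L.exists_height (v K) (cross2 B (x - v K)) (by rw [h.Y_w0]; exact hx.1) (by rw [h.top]; exact hx.2.1)
  obtain ⟨y', hy', e'⟩ := h.R.exists_height (v K) (-cross2 B (x - v K))
    (by rw [cross2_neg_left]; linarith [hx.2.1]) (by rw [cross2_neg_left, zz]; linarith [hx.1])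
  rw [cross2_neg_left, neg_inj] at e'
  have := h.sandwich hx (h.L.g_chain hy) (h.R.g_chain hy') e e'
  have m1 : y ∈ fB k K w v := Or.inr (Or.inl hy)
  have m2 : y' ∈ fB k K w v := Or.inr (Or.inr hy')
  exact (convex_convexHull ℝ (fB k K w v)).segment_subset (subset_convexHull ℝ _ m2)
    (subset_convexHull ℝ _ m1) this

theorem region_eq (h : Fnl B k K w v) :
    fB k K w v ∪ {p | p ∉ fB k K w v ∧ Bornology.IsBounded (connectedComponentIn (fB k K w v)ᶜ p)} = fF B k K w v := by
  ext p
  constructor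
  · rintro (hp | ⟨hp, hb⟩)
    · exact h.bdry_sub hp
    · by_contra hF
      have hBn := h.L.B_ne
      have ray0 : ∀ s : ℝ, cross2 B (p + s • B - v K) = cross2 B (p - v K) := by
        intro s; simp [cross2]; ring
      have conv1 : Convex ℝ {x | cross2 B (x - v K) < 0} := by
        intro x hx y hy a b ha hb hab
        simp only [Set.mem_ofPred_eq] at *
        rw [cross2_comb _ _ _ _ hab]
        obtain rfl : a = 1 - b := by linarith
        rcases hb.lt_or_eq with h | h
        · nlinarith [mul_nonneg ha (neg_nonneg.2 hx.le), mul_pos h (neg_pos.2 hy)]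
        · rw [← h]; linarith
      have conv2 : Convex ℝ {x | cross2 B (v 0 - v K) < cross2 B (x - v K)} := by
        intro x hx y hy a b ha hb hab
        simp only [Set.mem_ofPred_eq] at *
        rw [cross2_comb _ _ _ _ hab]
        obtain rfl : a = 1 - b := by linarith
        rcases hb.lt_or_eq with h | h
        · nlinarith [mul_nonneg ha (sub_nonneg.2 hx.le), mul_pos h (sub_pos.2 hy)]
        · rw [← h]; linarith
      by_cases h1 : 0 ≤ cross2 B (p - v K)
      · by_cases h2 : cross2 B (p - v K) ≤ cross2 B (v 0 - v K)
        · by_cases h3 : p ∈ chC k w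
          · exact not_bdd_of_ray (chC_convex k w) (fun x hx hxb => (h.bdry_sub hxb).2.2.1 hx) hBn
              (fun s hs => h.L.add_mem h3 hs) hb
          · by_cases h4 : p ∈ chC K v
            · exact not_bdd_of_ray (chC_convex K v) (fun x hx hxb => (h.bdry_sub hxb).2.2.2 hx) (neg_ne_zero.2 hBn)
                (fun s hs => h.R.add_mem h4 hs) hb
            · exact hF ⟨h1, h2, h3, h4⟩
        · exact not_bdd_of_ray conv2 (fun x hx hxb => not_lt.2 (h.bdry_sub hxb).2.1 hx) hBn
            (fun s hs => by simp only [Set.mem_ofPred_eq]; rw [ray0]; exact not_le.1 h2) hb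
      · exact not_bdd_of_ray conv1 (fun x hx hxb => not_lt.2 (h.bdry_sub hxb).1 hx) hBn
            (fun s hs => by simp only [Set.mem_ofPred_eq]; rw [ray0]; exact not_le.1 h1) hb
  · intro hp
    by_cases hpb : p ∈ fB k K w v
    · exact Or.inl hpb
    · right
      refine ⟨hpb, h.F_bounded.subset ?_⟩
      refine Set.Subset.trans ?_ (U_sub_F (B := B) (k := k) (K := K) (w := w) (v := v))
      refine isPreconnected_connectedComponentIn.subset_left_of_subset_union (U_open B k K w v)
        (F_closed B k K w v).isOpen_compl ?_ ?_ ⟨p, mem_connectedComponentIn hpb, h.F_sub_U hp hpb⟩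
      · rw [Set.disjoint_left]
        exact fun x hx hx' => hx' (U_sub_F hx)
      · intro x hx
        have hxb := connectedComponentIn_subset _ _ hx
        by_cases hxF : x ∈ fF B k K w v
        · exact Or.inl (h.F_sub_U hxF hxb)
        · exact Or.inr hxF

end Fnl

end

section
open SimplePolygon

lemma eps_exists (K : ℕ) (α β : ℕ → ℝ) (h0 : ∀ m < K, α m ≤ 0) (h1 : ∀ m < K, α m < 0 ∨ β m < 0) :
    ∃ ε : ℝ, 0 < ε ∧ ε ≤ 1 ∧ ∀ m < K, (1 - ε) * α m + ε * β m < 0 := by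
  have key : ∀ m ∈ Finset.range K, ∀ᶠ ε : ℝ in nhdsWithin 0 (Set.Ioi 0), (1 - ε) * α m + ε * β m < 0 := by
    intro m hm
    have hm := Finset.mem_range.1 hm
    rcases h1 m hm with h | h
    · have hc : Continuous (fun ε : ℝ => (1 - ε) * α m + ε * β m) := by fun_prop
      have := hc.tendsto 0
      simp only [sub_zero, one_mul, zero_mul, add_zero] at this
      exact (this.eventually (gt_mem_nhds h)).filter_mono nhdsWithin_le_nhds
    · have : ∀ᶠ ε : ℝ in nhdsWithin 0 (Set.Ioi 0), ε ∈ Set.Ioo (0:ℝ) 1 :=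
        Ioo_mem_nhdsGT one_pos
      filter_upwards [this] with ε hε
      nlinarith [mul_nonneg (sub_nonneg.2 hε.2.le) (neg_nonneg.2 (h0 m hm)), mul_pos hε.1 (neg_pos.2 h)]
  have k2 := (Filter.eventually_all_finset (Finset.range K)).2 key
  have k3 : ∀ᶠ ε : ℝ in nhdsWithin 0 (Set.Ioi 0), ε ∈ Set.Ioo (0:ℝ) 1 := Ioo_mem_nhdsGT one_pos
  obtain ⟨ε, h3, h4⟩ := (k2.and k3).exists
  exact ⟨ε, h4.1, h4.2.le, fun m hm => h3 m (Finset.mem_range.2 hm)⟩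

namespace Chain
variable {B : ℝ × ℝ} {K : ℕ} {w : ℕ → ℝ × ℝ}

lemma see_aux (h : Chain B K w) {p : ℝ × ℝ} (a : ℕ) (ha : a ≤ K)
    (hs : ∀ x ∈ segment ℝ p (w a), x ∉ chC K w) : ∃ m < K, gch w m (w a) = 0 ∧ 0 ≤ gch w m p := by
  by_contra hcon
  push Not at hcon
  obtain ⟨ε, h1, h2, h3⟩ := eps_exists K (fun m => gch w m (w a)) (fun m => gch w m p)
    (fun m hm => h.g_vtx m a hm ha) (fun m hm => by
      rcases (h.g_vtx m a hm ha).lt_or_eq with h | h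
      · exact Or.inl h
      · exact Or.inr (hcon m hm h))
  apply hs (ε • p + (1 - ε) • w a) ⟨ε, 1 - ε, h1.le, by linarith, by ring, rfl⟩
  intro m hm
  rw [gch_comb _ _ _ _ (by ring)]
  linarith [h3 m hm]

lemma see_low (h : Chain B K w) {p : ℝ × ℝ} (a : ℕ) (ha : a < K)
    (hs : ∀ x ∈ segment ℝ p (w a), x ∉ chC K w) : ∃ s ≤ a, 0 ≤ gch w s p := by
  obtain ⟨m, hm, h0, h1⟩ := h.see_aux a ha.le hs
  rcases le_or_gt m a with hma | hma
  · exact ⟨m, hma, h1⟩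
  · refine ⟨a, le_rfl, ?_⟩
    have e1 : gch w m (w a) = gch w m (w (a+1)) + cross2 (w (a+1) - w a) (w (m+1) - w m) := by
      unfold gch; simp [cross2]; ring
    have e2 := h.g_vtx m (a+1) hm (by omega)
    have e3 := h.slope a m hma.le hm
    have e4 : cross2 (w (a+1) - w a) (w (m+1) - w m) = 0 := by linarith
    have st := cross2_star (w (a+1) - w a) (w (m+1) - w m) (p - w a) B
    have e5 : cross2 (w (m+1) - w m) (p - w a) = gch w m p - gch w m (w a) := by
      unfold gch; simp [cross2]; ring
    rw [e4, e5, h0, cross2_anti (p - w a)] at st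
    change _ + - gch w a p * _ = 0 at st
    have u1 := h.up a ha
    have u2 := h.up m hm
    by_contra hc; push Not at hc
    nlinarith [mul_nonneg h1 u1.le, mul_pos (neg_pos.2 hc) u2]

lemma see_high (h : Chain B K w) {p : ℝ × ℝ} (c : ℕ) (hc : c + 1 ≤ K)
    (hs : ∀ x ∈ segment ℝ p (w (c+1)), x ∉ chC K w) : ∃ s, c ≤ s ∧ s < K ∧ 0 ≤ gch w s p := by
  obtain ⟨m, hm, h0, h1⟩ := h.see_aux (c+1) hc hs
  rcases le_or_gt c m with hma | hma
  · exact ⟨m, hma, hm, h1⟩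
  · refine ⟨c, le_rfl, by omega, ?_⟩
    have e1 : gch w m (w (c+1)) = gch w m (w c) + cross2 (w (m+1) - w m) (w (c+1) - w c) := by
      unfold gch; simp [cross2]; ring
    have e2 := h.g_vtx m c hm (by omega)
    have e3 := h.slope m c hma.le (by omega)
    have e4 : cross2 (w (m+1) - w m) (w (c+1) - w c) = 0 := by linarith
    have st := cross2_star (w (m+1) - w m) (w (c+1) - w c) (p - w (c+1)) B
    have e5 : cross2 (w (m+1) - w m) (p - w (c+1)) = gch w m p - gch w m (w (c+1)) := by
      unfold gch; simp [cross2]; ring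
    have e6 : cross2 (w (c+1) - w c) (p - w (c+1)) = gch w c p := by
      unfold gch; simp [cross2]; ring
    rw [e4, cross2_anti (p - w (c+1)), e5, e6, h0] at st
    have u1 := h.up c (by omega)
    have u2 := h.up m hm
    by_contra hc; push Not at hc
    nlinarith [mul_nonneg h1 u1.le, mul_pos (neg_pos.2 hc) u2]

lemma cone (h : Chain B K w) {p : ℝ × ℝ} {s j t : ℕ} (hsj : s ≤ j) (hjt : j ≤ t) (ht : t < K)
    (hs0 : 0 ≤ gch w s p) (ht0 : 0 ≤ gch w t p) : 0 ≤ gch w j p := by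
  have uj := h.up j (by omega)
  have key : ∀ i, cross2 (w (i+1) - w i) (p - w j) = gch w i p - gch w i (w j) := by
    intro i; unfold gch; simp [cross2]; ring
  by_contra hc; push Not at hc
  rcases le_total 0 (cross2 B (p - w j)) with hY | hY
  · have us := h.up s (by omega)
    have sl := h.slope s j hsj (by omega)
    have gs := h.g_vtx s j (by omega) (by omega)
    have st := cross2_star (w (s+1) - w s) (w (j+1) - w j) (p - w j) B
    rw [cross2_anti (p - w j), key s] at st
    change _ + gch w j p * _ + _ = 0 at st
    nlinarith [mul_pos (neg_pos.2 hc) us, mul_nonneg (by linarith : 0 ≤ gch w s p - gch w s (w j)) uj.le, mul_nonneg (neg_nonneg.2 sl) hY]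
  · have us := h.up t (by omega)
    have sl := h.slope j t hjt (by omega)
    have gs := h.g_vtx t j (by omega) (by omega)
    have st := cross2_star (w (t+1) - w t) (w (j+1) - w j) (p - w j) B
    rw [cross2_anti (p - w j), key t, cross2_anti (w (t+1) - w t) (w (j+1) - w j)] at st
    change _ + gch w j p * _ + _ = 0 at st
    nlinarith [mul_pos (neg_pos.2 hc) us, mul_nonneg (by linarith : 0 ≤ gch w t p - gch w t (w j)) uj.le, mul_nonneg (neg_nonneg.2 sl) (neg_nonneg.2 hY)]

end Chain

namespace Fnl
variable {B : ℝ × ℝ} {k K : ℕ} {w v : ℕ → ℝ × ℝ}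

lemma visR (h : Fnl B k K w v) {p : ℝ × ℝ} (hp : p ∈ fF B k K w v) (b c : ℕ) (hbc : b < c) (hc : c ≤ k)
    (hg : ∀ j, b ≤ j → j < c → 0 ≤ gch w j p) (hsee : ∀ x ∈ segment ℝ p (w c), x ∉ chC K v) :
    ∀ q ∈ segment ℝ p (w b), q ∉ chC K v := by
  rintro q ⟨l, κ, hl, hκ, hlκ, hq⟩ hqC
  have hk := h.L.hK
  have hK := h.R.hK
  have Yw : ∀ j ≤ k, cross2 B (w j - v K) ≤ cross2 B (v 0 - v K) := by
    intro j hj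
    have := h.L.mono j k hj le_rfl (v K)
    rwa [h.top] at this
  have Yq : cross2 B (q - v K) ≤ cross2 B (v 0 - v K) := by
    rw [← hq, cross2_comb _ _ _ _ hlκ]
    obtain rfl : l = 1 - κ := by linarith
    nlinarith [mul_nonneg hl (sub_nonneg.2 hp.2.1), mul_nonneg hκ (sub_nonneg.2 (Yw b (by omega)))]
  have gq := h.sep_L Yq (hqC 0 hK)
  have gw : ∀ j ≤ k, gch w (k-1) (w j) ≤ 0 := fun j hj => h.L.g_vtx (k-1) j (by omega) hj
  have gq' : gch w (k-1) q = l * gch w (k-1) p + κ * gch w (k-1) (w b) := by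
    rw [← hq, gch_comb _ _ _ _ hlκ]
  have hgb := gw b (by omega)
  have lp : 0 < l * gch w (k-1) p := by nlinarith
  have P0 : 0 < gch w (k-1) p := by
    by_contra hcon; push Not at hcon; nlinarith
  have gqp : gch w (k-1) q ≤ gch w (k-1) p := by nlinarith
  -- the vertex vectors seen from p
  have hD : ∀ j ≤ k, cross2 (w k - w (k-1)) (w j - p) = gch w (k-1) (w j) - gch w (k-1) p := by
    intro j hj; unfold gch; rw [show k - 1 + 1 = k by omega]; simp [cross2]; ring
  have hA : ∀ j, cross2 (w j - p) (w (j+1) - p) = gch w j p := by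
    intro j; unfold gch; simp [cross2]; ring
  have hbc' : ∀ j, b ≤ j → j ≤ c → 0 ≤ cross2 (w b - p) (w j - p) := by
    intro j hj
    induction j, hj using Nat.le_induction with
    | base => intro _; rw [cross2_self]
    | succ j hj ih =>
      intro hjc
      have i1 := ih (by omega)
      have i2 := hg j hj (by omega)
      have st := cross2_star (w b - p) (w j - p) (w (j+1) - p) (w k - w (k-1))
      rw [hD b (by omega), hD j (by omega), hD (j+1) (by omega), hA, cross2_anti (w (j+1) - p)] at st
      have d1 := gw b (by omega)
      have d2 := gw j (by omega)
      have d3 := gw (j+1) (by omega)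
      by_contra hcon; push Not at hcon
      nlinarith [mul_nonneg i1 (by linarith : 0 ≤ gch w (k-1) p - gch w (k-1) (w (j+1))),
        mul_nonneg i2 (by linarith : 0 ≤ gch w (k-1) p - gch w (k-1) (w b)),
        mul_pos (neg_pos.2 hcon) (by linarith : 0 < gch w (k-1) p - gch w (k-1) (w j))]
  have Nq : cross2 (w c - p) (q - p) ≤ 0 := by
    have e : q - p = κ • (w b - p) := by
      rw [← hq]; obtain rfl : l = 1 - κ := by linarith
      ext <;> simp <;> ring
    rw [e, cross2_smul_right, cross2_anti]
    nlinarith [hbc' c (by omega) le_rfl]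
  have uk := h.L.up (k-1) (by omega)
  rw [show k - 1 + 1 = k by omega] at uk
  have hAlpha : ∀ m < K, gch v m (w k) ≤ 0 := by
    intro m hm; rw [h.top]; exact h.R.g_vtx m 0 hm (by omega)
  -- points of the half-open segment from q to the apex are forbidden
  have hqa : ∀ μ : ℝ, 0 ≤ μ → μ < 1 → (1 - μ) • q + μ • w k ∈ chC K v := by
    intro μ h0 h1 m hm
    rw [gch_comb _ _ _ _ (by ring)]
    nlinarith [mul_pos (sub_pos.2 h1) (neg_pos.2 (hqC m hm)), mul_nonneg h0 (neg_nonneg.2 (hAlpha m hm))]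
  have hYqa : ∀ μ : ℝ, 0 ≤ μ → μ < 1 → cross2 B ((1 - μ) • q + μ • w k - v K) ≤ cross2 B (v 0 - v K) := by
    intro μ h0 h1
    rw [cross2_comb _ _ _ _ (by ring)]
    nlinarith [mul_nonneg (sub_nonneg.2 h1.le) (sub_nonneg.2 Yq), mul_nonneg h0 (sub_nonneg.2 (Yw k le_rfl))]
  have gkk : gch w (k-1) (w k) = 0 := by unfold gch; rw [show k - 1 + 1 = k by omega, cross2_self]
  rcases Nat.lt_or_ge c k with hck | hck
  · -- N at the apex is positive
    have Na : 0 < cross2 (w c - p) (w k - p) := by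
      have st := cross2_star (w c - p) (w k - p) (w k - w (k-1)) B
      rw [cross2_anti (w k - p) (w k - w (k-1)), hD k le_rfl, hD c hc, gkk] at st
      have e1 : cross2 B (w k - p) = cross2 B (w k - v K) - cross2 B (p - v K) := by
        rw [← cross2_sub_right]; congr 1; abel
      have e2 : cross2 B (w c - p) = cross2 B (w c - v K) - cross2 B (p - v K) := by
        rw [← cross2_sub_right]; congr 1; abel
      have hlt : cross2 B (w c - v K) < cross2 B (w k - v K) := by
        have h1 := h.L.mono (c+1) k (by omega) le_rfl (v K)
        have h2 := h.L.up c hck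
        have e3 : cross2 B (w (c+1) - w c) = cross2 B (w (c+1) - v K) - cross2 B (w c - v K) := by
          rw [← cross2_sub_right]; congr 1; abel
        linarith
      have hYp := hp.2.1
      rw [← h.top] at hYp
      have hgc := gw c hc
      by_contra hcon; push Not at hcon
      rw [e1, e2] at st
      nlinarith [mul_pos P0 (sub_pos.2 hlt), mul_nonneg (neg_nonneg.2 hgc) (sub_nonneg.2 hYp), mul_nonneg (neg_nonneg.2 hcon) uk.le]
    set n1 := cross2 (w c - p) (q - p)
    set n2 := cross2 (w c - p) (w k - p)
    have hn : 0 < n2 - n1 := by linarith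
    set μ := -n1 / (n2 - n1) with hμ
    have hμ' : μ * (n2 - n1) = -n1 := by rw [hμ]; field_simp
    have hμ0 : 0 ≤ μ := div_nonneg (by linarith) hn.le
    have hμ1 : μ < 1 := by rw [hμ, div_lt_one hn]; linarith
    have hxC := hqa μ hμ0 hμ1
    have hxY := hYqa μ hμ0 hμ1
    have gx := h.sep_L hxY (hxC 0 hK)
    have gx' : gch w (k-1) ((1 - μ) • q + μ • w k) = (1 - μ) * gch w (k-1) q := by
      rw [gch_comb _ _ _ _ (by ring), gkk]; ring
    have Nx : cross2 (w c - p) ((1 - μ) • q + μ • w k - p) = 0 := by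
      rw [cross2_comb _ _ _ _ (by ring)]; linarith
    have hDc := hD c hc
    have hgc := gw c hc
    have hne : w c - p ≠ 0 := by
      intro h0; rw [h0] at hDc
      have : cross2 (w k - w (k-1)) 0 = 0 := by simp [cross2]
      linarith
    obtain ⟨τ, hτ⟩ := cross2_zero_imp hne Nx
    set x := (1 - μ) • q + μ • w k
    have hxe : x = (1 - τ) • p + τ • w c := by
      have : x = p + τ • (w c - p) := by rw [← hτ]; abel
      rw [this]; ext <;> simp <;> ring
    have gx2 : gch w (k-1) x = (1 - τ) * gch w (k-1) p + τ * gch w (k-1) (w c) := by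
      rw [hxe, gch_comb _ _ _ _ (by ring)]
    have hτ0 : 0 ≤ τ := by
      by_contra hcon; push Not at hcon
      nlinarith [mul_pos (neg_pos.2 hcon) (by linarith : 0 < gch w (k-1) p - gch w (k-1) (w c))]
    have hτ1 : τ ≤ 1 := by
      by_contra hcon; push Not at hcon
      nlinarith [mul_pos (sub_pos.2 hcon) (by linarith : 0 < gch w (k-1) p - gch w (k-1) (w c))]
    exact hsee x ⟨1 - τ, τ, by linarith, hτ0, by ring, hxe.symm⟩ hxC
  · obtain rfl : c = k := by omega
    have zz : cross2 B (v K - v K) = 0 := by simp [cross2]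
    have hYp : cross2 B (p - v K) < cross2 B (v 0 - v K) := by
      apply lt_of_le_of_ne hp.2.1
      intro he
      have := h.sandwich hp (fun m hm => h.L.g_vtx m c hm le_rfl) (fun m hm => h.R.g_vtx m 0 hm (by omega))
        (by rw [h.top, he]) (by rw [he])
      rw [h.top, segment_same, Set.mem_singleton_iff, ← h.top] at this
      rw [this] at P0
      linarith
    have hap : cross2 B (w c - p) = cross2 B (v 0 - v K) - cross2 B (p - v K) := by
      rw [h.top, ← cross2_sub_right]; congr 1; abel
    rcases le_or_gt (cross2 B (p - v K)) (cross2 B (q - v K)) with hpq | hpq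
    · set d := cross2 B (v 0 - v K) - cross2 B (p - v K) with hd
      have hd0 : 0 < d := by linarith
      set τ := (cross2 B (q - v K) - cross2 B (p - v K)) / d with hτ
      have hτ' : τ * d = cross2 B (q - v K) - cross2 B (p - v K) := by rw [hτ]; field_simp
      have hτ0 : 0 ≤ τ := div_nonneg (by linarith) hd0.le
      have hτ1 : τ ≤ 1 := by rw [hτ, div_le_one hd0]; linarith
      have hY : cross2 B (q - ((1 - τ) • p + τ • w c)) = 0 := by
        have e := cross2_comb B (v K) p (w c) (show (1 - τ) + τ = 1 by ring)
        rw [show q - ((1 - τ) • p + τ • w c) = (q - v K) - ((1 - τ) • p + τ • w c - v K) by abel, cross2_sub_right, e, h.top]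
        linarith
      obtain ⟨s, hs⟩ := cross2_zero_imp h.L.B_ne hY
      have hN : cross2 (w c - p) (q - ((1 - τ) • p + τ • w c)) = cross2 (w c - p) (q - p) := by
        simp [cross2]; ring
      rw [hs, cross2_smul_right, cross2_anti, hap] at hN
      have hs0 : 0 ≤ s := by
        by_contra hcon; push Not at hcon
        nlinarith [mul_pos (neg_pos.2 hcon) hd0]
      refine hsee ((1 - τ) • p + τ • w c) ⟨1 - τ, τ, by linarith, hτ0, by ring, rfl⟩ ?_
      have := h.R.add_mem hqC hs0
      rw [smul_neg, ← hs] at this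
      simpa using this
    · set d := cross2 B (v 0 - v K) - cross2 B (q - v K) with hd
      have hd0 : 0 < d := by linarith
      set μ := (cross2 B (p - v K) - cross2 B (q - v K)) / d with hμ
      have hμ' : μ * d = cross2 B (p - v K) - cross2 B (q - v K) := by rw [hμ]; field_simp
      have hμ0 : 0 ≤ μ := div_nonneg (by linarith) hd0.le
      have hμ1 : μ < 1 := by rw [hμ, div_lt_one hd0]; linarith
      have hxC := hqa μ hμ0 hμ1
      have hY : cross2 B ((1 - μ) • q + μ • w c - p) = 0 := by
        have e := cross2_comb B (v K) q (w c) (show (1 - μ) + μ = 1 by ring)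
        rw [show (1 - μ) • q + μ • w c - p = ((1 - μ) • q + μ • w c - v K) - (p - v K) by abel, cross2_sub_right, e, h.top]
        linarith
      obtain ⟨s, hs⟩ := cross2_zero_imp h.L.B_ne hY
      have hN : cross2 (w c - p) ((1 - μ) • q + μ • w c - p) = (1 - μ) * cross2 (w c - p) (q - p) := by
        rw [cross2_comb _ _ _ _ (by ring), cross2_self]; ring
      rw [hs, cross2_smul_right, cross2_anti (w c - p) B, hap] at hN
      have hs0 : 0 ≤ s := by
        by_contra hcon; push Not at hcon
        nlinarith [mul_pos (neg_pos.2 hcon) (sub_pos.2 hYp), mul_nonneg (sub_nonneg.2 hμ1.le) (neg_nonneg.2 Nq)]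
      apply hp.2.2.2
      have := h.R.add_mem hxC hs0
      rw [smul_neg, ← hs] at this
      simpa using this

theorem vis (h : Fnl B k K w v) {p : ℝ × ℝ} (a b c : ℕ) (hab : a ≤ b) (hbc : b ≤ c) (hc : c ≤ k)
    (ha1 : segment ℝ p (w a) ⊆ fF B k K w v) (hc1 : segment ℝ p (w c) ⊆ fF B k K w v) :
    segment ℝ p (w b) ⊆ fF B k K w v := by
  rcases hab.eq_or_lt with rfl | hab
  · exact ha1
  rcases hbc.eq_or_lt with rfl | hbc
  · exact hc1
  have hp := ha1 (left_mem_segment ℝ _ _)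
  obtain ⟨s, hs, hs0⟩ := h.L.see_low (p := p) a (by omega) (fun x hx => (ha1 hx).2.2.1)
  obtain ⟨d, rfl⟩ : ∃ d, c = d + 1 := ⟨c - 1, by omega⟩
  obtain ⟨t, ht, htk, ht0⟩ := h.L.see_high (p := p) d hc (fun x hx => (hc1 hx).2.2.1)
  have hg : ∀ j, b ≤ j → j < d + 1 → 0 ≤ gch w j p := fun j h1 h2 =>
    h.L.cone (by omega) (by omega) htk hs0 ht0
  have hR := h.visR hp b (d+1) hbc hc hg (fun x hx => (hc1 hx).2.2.2)
  have hwb0 : w b ∈ fB k K w v := Or.inr (Or.inl ⟨b, by omega, left_mem_segment ℝ _ _⟩)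
  have hwb := h.bdry_sub hwb0
  intro x hx
  refine ⟨?_, ?_, ?_, hR x hx⟩
  · obtain ⟨l, κ, hl, hκ, hlκ, rfl⟩ := hx
    rw [cross2_comb _ _ _ _ hlκ]
    have := mul_nonneg hl hp.1
    have := mul_nonneg hκ hwb.1
    linarith
  · obtain ⟨l, κ, hl, hκ, hlκ, rfl⟩ := hx
    rw [cross2_comb _ _ _ _ hlκ]
    obtain rfl : l = 1 - κ := by linarith
    nlinarith [mul_nonneg hl (sub_nonneg.2 hp.2.1), mul_nonneg hκ (sub_nonneg.2 hwb.2.1)]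
  · obtain ⟨l, κ, hl, hκ, hlκ, rfl⟩ := hx
    intro hC
    have h1 := hC b (by omega)
    rw [gch_comb _ _ _ _ hlκ] at h1
    have h2 : gch w b (w b) = 0 := by simp [gch, cross2]
    have h3 := mul_nonneg hl (hg b le_rfl (by omega))
    rw [h2] at h1
    linarith

end Fnl

end

section
open SimplePolygon

def toC (x : ℝ × ℝ) : ℂ := ⟨x.1, x.2⟩

lemma toC_inj : Function.Injective toC := by
  intro x y h
  have h1 := congrArg Complex.re h
  have h2 := congrArg Complex.im h
  exact Prod.ext h1 h2

lemma toC_seg (x y : ℝ × ℝ) : segment ℝ (toC x) (toC y) = toC '' segment ℝ x y := by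
  have := image_segment ℝ (Complex.equivRealProdLm.symm : ℝ × ℝ →ₗ[ℝ] ℂ).toAffineMap x y
  have e : ∀ x, (Complex.equivRealProdLm.symm : ℝ × ℝ →ₗ[ℝ] ℂ).toAffineMap x = toC x := by
    intro x; apply Complex.ext <;> simp [toC]
  rw [← e, ← e, ← this]
  apply Set.image_congr
  intro a _
  exact e a

lemma toC_ccr (x y : ℝ × ℝ) : ccr (toC x) (toC y) = cross2 x y := rfl
lemma toC_sub (x y : ℝ × ℝ) : toC x - toC y = toC (x - y) := by
  apply Complex.ext <;> simp [toC]

/-- cyclic index starting at `b` -/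
def cix (P : SimplePolygon) (b : Fin P.n) (m : ℕ) : Fin P.n := Fin.ofNat P.n (b.val + m)

lemma cix_val (P : SimplePolygon) (b : Fin P.n) (m : ℕ) : (cix P b m).val = (b.val + m) % P.n := rfl

lemma cix_succ (P : SimplePolygon) (b : Fin P.n) (m : ℕ) : cix P b (m+1) = cix P b m + 1 := by
  apply Fin.ext
  rw [Fin.val_add, cix_val, cix_val]
  have : ((1 : Fin P.n) : ℕ) = 1 % P.n := Fin.val_one' _
  rw [this, ← Nat.add_mod]
  rfl

lemma cix_zero (P : SimplePolygon) (b : Fin P.n) : cix P b 0 = b := by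
  apply Fin.ext
  rw [cix_val]
  exact Nat.mod_eq_of_lt b.2

lemma cix_per (P : SimplePolygon) (b : Fin P.n) (m : ℕ) : cix P b (m + P.n) = cix P b m := by
  apply Fin.ext
  rw [cix_val, cix_val, ← add_assoc, Nat.add_mod_right]

lemma cix_ne (P : SimplePolygon) (b : Fin P.n) (s j : ℕ) (h1 : 1 ≤ j) (h2 : j < P.n) :
    cix P b (s + j) ≠ cix P b s := by
  intro h
  have h := congrArg Fin.val h
  rw [cix_val, cix_val, ← add_assoc] at h
  have h3 : (b.val + s + j) ≡ (b.val + s + 0) [MOD P.n] := h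
  have h4 := Nat.ModEq.add_left_cancel' _ h3
  have h5 := Nat.ModEq.eq_of_lt_of_lt h4 h2 (by omega)
  omega

lemma cix_ne' (P : SimplePolygon) (b : Fin P.n) (s t : ℕ) (h1 : s < t) (h2 : t < s + P.n) :
    cix P b t ≠ cix P b s := by
  obtain ⟨j, rfl⟩ := Nat.exists_eq_add_of_lt h1
  exact cix_ne P b s (j+1) (by omega) (by omega)

lemma cix_surj (P : SimplePolygon) (b i : Fin P.n) : ∃ m < P.n, cix P b m = i := by
  have h := P.three_le
  by_cases hb : b.val ≤ i.val
  · refine ⟨i.val - b.val, by omega, Fin.ext ?_⟩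
    rw [cix_val, Nat.add_sub_cancel' hb]
    exact Nat.mod_eq_of_lt i.2
  · refine ⟨i.val + P.n - b.val, by omega, Fin.ext ?_⟩
    rw [cix_val, show b.val + (i.val + P.n - b.val) = i.val + P.n by omega, Nat.add_mod_right]
    exact Nat.mod_eq_of_lt i.2

lemma cix_cpoly (P : SimplePolygon) (b : Fin P.n) (N : ℕ) (hN : P.n = N + 2) :
    CPoly N (fun m => toC (P.vtx (cix P b m))) where
  hN := by have := P.three_le; omega
  per := by
    intro i
    show toC (P.vtx (cix P b (i + (N+2)))) = _
    rw [← hN, cix_per]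
  ne := by
    intro s j h1 h2 h
    exact cix_ne P b s j h1 (by omega) (P.inj (toC_inj h))
  disj := by
    intro s j h1 h2
    simp only [toC_seg]
    rw [Set.disjoint_image_iff toC_inj, Set.disjoint_iff_inter_eq_empty]
    rw [cix_succ P b s, cix_succ P b (s+j)]
    apply P.nonconsec_edges
    · exact (cix_ne' P b s (s+j) (by omega) (by omega)).symm
    · have := cix_ne' P b (s+1) (s+j) (by omega) (by omega)
      rwa [cix_succ] at this
    · have := (cix_ne' P b s (s+j+1) (by omega) (by omega)).symm
      rwa [cix_succ] at this
  bend := by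
    intro s
    simp only [toC_seg]
    rw [← Set.image_inter toC_inj, ← Set.image_singleton]
    congr 1
    have := P.consec_edges (cix P b s)
    rw [show s + 2 = s + 1 + 1 by rfl, cix_succ P b (s+1), cix_succ P b s]
    exact this

lemma cix_area (P : SimplePolygon) (b : Fin P.n) (hccw : P.Ccw) :
    0 < ∑ j ∈ Finset.range P.n, ccr (toC (P.vtx (cix P b j))) (toC (P.vtx (cix P b (j+1)))) := by
  unfold Ccw at hccw
  rw [← Equiv.sum_comp (Equiv.addLeft b)] at hccw
  rw [Finset.sum_range]
  refine lt_of_lt_of_eq hccw (Finset.sum_congr rfl ?_)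
  intro i _
  rw [toC_ccr, cix_succ]
  have : (Equiv.addLeft b) i = cix P b i.val := by
    apply Fin.ext
    rw [cix_val]
    exact Fin.val_add _ _
  rw [this]

theorem funnel_main (P : SimplePolygon)
    (hccw : P.Ccw) (b c : Fin P.n) (hc1 : c ≠ b) (hc2 : c ≠ b + 1)
    (hconv : {i : Fin P.n | P.ConvexVtx i} = {b, b + 1, c})
    (L : ℕ → Fin P.n) (k : ℕ) (hk : k < P.n)
    (hL0 : L 0 = b + 1) (hLsucc : ∀ t : ℕ, L (t + 1) = L t + 1)
    (hLk : L k = c) :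
    ∀ p ∈ P.region, ∀ t₁ t₂ t₃ : ℕ, t₁ ≤ t₂ → t₂ ≤ t₃ → t₃ ≤ k →
      P.Sees p (P.vtx (L t₁)) → P.Sees p (P.vtx (L t₃)) →
      P.Sees p (P.vtx (L t₂)) := by
  obtain ⟨N, hN⟩ : ∃ N, P.n = N + 2 := ⟨P.n - 2, by have := P.three_le; omega⟩
  have hLc : ∀ t, L t = cix P b (t+1) := by
    intro t
    induction t with
    | zero => rw [hL0, cix_succ, cix_zero]
    | succ t ih => rw [hLsucc, ih, ← cix_succ]
  have hk1 : 1 ≤ k := by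
    by_contra h
    obtain rfl : k = 0 := by omega
    exact hc2 (hLk.symm.trans hL0)
  have hk2 : k ≤ N := by
    by_contra h
    obtain rfl : k = N + 1 := by omega
    apply hc1
    rw [← hLk, hLc, show N + 1 + 1 = 0 + P.n by omega, cix_per, cix_zero]
  set u : ℕ → ℝ × ℝ := fun m => P.vtx (cix P b m) with hu
  have hcp := cix_cpoly P b N hN
  have harea := cix_area P b hccw
  rw [hN] at harea
  have hC := hcp.turn_ge harea
  have hcv : ∀ s, (0 < cross2 (u (s+1) - u s) (u (s+2) - u (s+1))) ↔
      (cix P b (s+1) = b ∨ cix P b (s+1) = b + 1 ∨ cix P b (s+1) = c) := by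
    intro s
    have h := Set.ext_iff.1 hconv (cix P b (s+1))
    simp only [Set.mem_setOf_eq, Set.mem_insert_iff, Set.mem_singleton_iff, ConvexVtx] at h
    rw [← h, ← cix_succ, cix_succ P b s, add_sub_cancel_right, ← cix_succ]
  have hb0 := cix_zero P b
  have hb1 : cix P b 1 = b + 1 := by rw [cix_succ, cix_zero]
  have hbk : cix P b (k+1) = c := by rw [← hLc, hLk]
  have hneg : ∀ s, 1 ≤ s → s ≤ N → s ≠ k → cross2 (u (s+1) - u s) (u (s+2) - u (s+1)) ≤ 0 := by
    intro s h1 h2 h3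
    rw [← not_lt, hcv]
    rintro (h | h | h)
    · rw [← hb0, hb0] at h
      exact cix_ne' P b 0 (s+1) (by omega) (by omega) (h.trans hb0.symm)
    · exact cix_ne' P b 1 (s+1) (by omega) (by omega) (h.trans hb1.symm)
    · rcases lt_or_gt_of_ne h3 with h4 | h4
      · exact cix_ne' P b (s+1) (k+1) (by omega) (by omega) (hbk.trans h.symm)
      · exact cix_ne' P b (k+1) (s+1) (by omega) (by omega) (h.trans hbk.symm)
  have hpos : ∀ s, s = 0 ∨ s = k ∨ s = N+1 → 0 < cross2 (u (s+1) - u s) (u (s+2) - u (s+1)) := by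
    intro s hs
    rw [hcv]
    rcases hs with rfl | rfl | rfl
    · exact Or.inr (Or.inl hb1)
    · exact Or.inr (Or.inr hbk)
    · left
      rw [show N + 1 + 1 = 0 + P.n by omega, cix_per, cix_zero]
  have hd := hcp.directions hC k hk1 hk2
    (by intro s h1 h2 h3; simp only [toC_sub, toC_ccr]; exact hneg s h1 h2 h3)
    (by intro s hs; simp only [toC_sub, toC_ccr]; exact hpos s hs)
  simp only [toC_sub, toC_ccr] at hd
  obtain ⟨hd1, hd2⟩ := hd
  have huN : u (N+2) = u 0 := by
    simp only [hu]
    rw [← hN, ← Nat.zero_add P.n, cix_per]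
  obtain ⟨K, hK⟩ : ∃ K, K + k = N + 1 := ⟨N + 1 - k, by omega⟩
  have hF : Fnl (u 1 - u 0) k K (fun j => u (j+1)) (fun j => u (k+1+j)) := by
    refine ⟨⟨hk1, ?_, ?_⟩, ⟨by omega, ?_, ?_⟩, rfl, ?_, ?_⟩
    · intro m hm
      exact hd1 (m+1) (by omega) (by omega)
    · intro m hm
      exact hneg (m+1) (by omega) (by omega) (by omega)
    · intro m hm
      have := hd2 (k+1+m) (by omega) (by omega)
      rw [cross2_neg_left]
      show 0 < - cross2 (u 1 - u 0) (u (k+1+m+1) - u (k+1+m))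
      exact neg_pos.2 this
    · intro m hm
      exact hneg (k+1+m) (by omega) (by omega) (by omega)
    · show u 1 = u (k+1+K) + (u 1 - u 0)
      rw [show k + 1 + K = N + 2 by omega, huN]
      abel
    · have := hpos k (by simp)
      show 0 < cross2 (u (k+1) - u (k-1+1)) (u (k+1+1) - u (k+1))
      rw [Nat.sub_add_cancel hk1]
      exact this
  have hbd : P.boundary = fB k K (fun j => u (j+1)) (fun j => u (k+1+j)) := by
    ext x
    unfold fB boundary chP
    simp only [Set.mem_iUnion, Set.mem_union, Set.mem_setOf_eq, zero_add]
    rw [show k + 1 + K = N + 2 by omega, huN]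
    have hex : (∃ i, x ∈ segment ℝ (P.vtx i) (P.vtx (i+1))) ↔
        ∃ m < P.n, x ∈ segment ℝ (u m) (u (m+1)) := by
      constructor
      · rintro ⟨i, hi⟩
        obtain ⟨m, hm, rfl⟩ := cix_surj P b i
        refine ⟨m, hm, ?_⟩
        simp only [hu, cix_succ]
        exact hi
      · rintro ⟨m, hm, h⟩
        refine ⟨cix P b m, ?_⟩
        simp only [hu, cix_succ] at h
        exact h
    rw [hex]
    constructor
    · rintro ⟨m, hm, h⟩
      rcases Nat.eq_zero_or_pos m with rfl | h0
      · exact Or.inl h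
      right
      by_cases hmk : m ≤ k
      · left
        refine ⟨m - 1, by omega, ?_⟩
        rw [Nat.sub_add_cancel h0]
        exact h
      · right
        refine ⟨m - (k+1), by omega, ?_⟩
        rw [← add_assoc, Nat.add_sub_cancel' (by omega : k + 1 ≤ m)]
        exact h
    · rintro (h | ⟨m, hm, h⟩ | ⟨m, hm, h⟩)
      · exact ⟨0, by omega, h⟩
      · exact ⟨m+1, by omega, h⟩
      · exact ⟨k+1+m, by omega, h⟩
  have hreg : P.region = fF (u 1 - u 0) k K (fun j => u (j+1)) (fun j => u (k+1+j)) := by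
    rw [← hF.region_eq]
    unfold region
    rw [hbd]
  intro p _ t₁ t₂ t₃ h12 h23 h3 hs1 hs3
  unfold Sees at *
  rw [hreg] at *
  rw [hLc] at *
  exact hF.vis t₁ t₂ t₃ h12 h23 h3 hs1 hs3

end

/-- Let `F` be a funnel with base edge joining the adjacent
convex vertices `vtx b` and `vtx (b+1)` and apex `vtx c`, and let
`L 0 = b + 1, L 1, …, L k = c` (with `L (t+1) = L t + 1`) be the indices of
the chain of vertices in order along the boundary from the base endpoint
`l₁ = vtx (b+1)` to the apex, not passing through the other base endpoint
`r₁ = vtx b`. Then for every point `p` of the funnel, the set of indices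
`{t : p sees vtx (L t)}` is a set of consecutive integers: any point of a
funnel sees a consecutive section of each of its two chains. -/
theorem funnel_sees_consecutive_chain_section (P : SimplePolygon)
    (hccw : P.Ccw) (b c : Fin P.n) (hc1 : c ≠ b) (hc2 : c ≠ b + 1)
    (hconv : {i : Fin P.n | P.ConvexVtx i} = {b, b + 1, c})
    (L : ℕ → Fin P.n) (k : ℕ) (hk : k < P.n)
    (hL0 : L 0 = b + 1) (hLsucc : ∀ t : ℕ, L (t + 1) = L t + 1)
    (hLk : L k = c) :
    ∀ p ∈ P.region, ∀ t₁ t₂ t₃ : ℕ, t₁ ≤ t₂ → t₂ ≤ t₃ → t₃ ≤ k →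
      P.Sees p (P.vtx (L t₁)) → P.Sees p (P.vtx (L t₃)) →
      P.Sees p (P.vtx (L t₂)) := by
  exact funnel_main P hccw b c hc1 hc2 hconv L k hk hL0 hLsucc hLk
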